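/- Let h : ℝ → ℝ be a function with h(x)/(log x)^{1/2} → 0 as x → ∞. Then, as x → ∞, the number of squarefree positive integers n ≤ x for which there exists a quadratic number field K with |Δ_K| ≤ h(x) such that no prime factor of n splits in K, is o(x); that is, for every ε > 0 there exists x₀ such that for all x ≥ x₀ this count is at most ε·x. (Since squarefree integers n that are finite discriminants of indefinite rational quaternion algebras admitting an embedding of a quadratic field K are exactly those having no prime factor split in K, this shows that among quaternion algebras B over ℚ with disc_f(B) < x, those not admitting an embedding of any quadratic field of absolute discriminant less than h(x) have density one.) -/

import Mathlib

open NumberField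

/-- A rational prime `p` splits in the number field `K` if there are two distinct (nonzero)
prime ideals of `𝓞 K` lying above `p`. -/
def RatPrimeSplits (K : Type*) [Field K] [NumberField K] (p : ℕ) : Prop :=
  ∃ Q₁ Q₂ : Ideal (𝓞 K), Q₁ ≠ Q₂ ∧ Q₁.IsPrime ∧ Q₂.IsPrime ∧ Q₁ ≠ ⊥ ∧ Q₂ ≠ ⊥ ∧
    Q₁.comap (algebraMap ℤ (𝓞 K)) = Ideal.span {(p : ℤ)} ∧
    Q₂.comap (algebraMap ℤ (𝓞 K)) = Ideal.span {(p : ℤ)}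

/-- `K` is a quadratic field of absolute discriminant at most `H` in which no prime factor of
`n` splits. -/
def BadWitness (H : ℝ) (n : ℕ) (K : Type) [Field K] [NumberField K] : Prop :=
  Module.finrank ℚ K = 2 ∧ |(NumberField.discr K : ℝ)| ≤ H ∧
    ∀ p : ℕ, p.Prime → p ∣ n → ¬ RatPrimeSplits K p

lemma exists_maximal_ideal_mem {K : Type*} [Field K] [NumberField K] {m : ℤ} {θ : 𝓞 K}
    (hθ : θ ^ 2 = (m : 𝓞 K)) (htr : Algebra.trace ℤ (𝓞 K) θ = 0)
    (hK : Module.finrank ℚ K = 2) {p : ℕ} (a : ℤ)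
    (ha : (p : ℤ) ∣ m - a ^ 2) (h2a : ¬ (p : ℤ) ∣ 2 * a) :
    ∃ Q : Ideal (𝓞 K), Q.IsMaximal ∧ (p : 𝓞 K) ∈ Q ∧ θ - a ∈ Q := by
  have hne : Ideal.span {(p : 𝓞 K), θ - a} ≠ ⊤ := by
    intro h
    rw [Ideal.eq_top_iff_one, Ideal.mem_span_pair] at h
    obtain ⟨α, β, h⟩ := h
    obtain ⟨c, hc⟩ := ha
    have hc' : (m : 𝓞 K) - a ^ 2 = p * c := by exact_mod_cast congrArg (Int.cast : ℤ → 𝓞 K) hc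
    have h2 : θ + a = (p : ℤ) • (α * (θ + a) + β * c) := by
      rw [zsmul_eq_mul]
      push_cast
      linear_combination (-(θ + a)) * h + β * hθ + β * hc'
    have h3 := congrArg (Algebra.trace ℤ (𝓞 K)) h2
    rw [map_add, htr, map_smul, zero_add, smul_eq_mul] at h3
    have h4 : Algebra.trace ℤ (𝓞 K) (a : 𝓞 K) = 2 * a := by
      have := Algebra.trace_algebraMap (S := 𝓞 K) a
      rw [RingOfIntegers.rank, hK] at this
      simpa using this
    exact h2a ⟨_, h4 ▸ h3⟩
  obtain ⟨Q, hQ, hle⟩ := Ideal.exists_le_maximal _ hne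
  exact ⟨Q, hQ, hle (Ideal.subset_span (by simp)), hle (Ideal.subset_span (by simp))⟩

lemma comap_eq_span_of_mem {K : Type*} [Field K] [NumberField K] {p : ℕ} (hp : p.Prime)
    {Q : Ideal (𝓞 K)} (hQ : Q.IsMaximal) (hpQ : (p : 𝓞 K) ∈ Q) :
    Q.comap (algebraMap ℤ (𝓞 K)) = Ideal.span {(p : ℤ)} := by
  have hmax : (Ideal.span {(p : ℤ)}).IsMaximal :=
    PrincipalIdealRing.isMaximal_of_irreducible (Nat.prime_iff_prime_int.mp hp).irreducible
  refine (hmax.eq_of_le (Ideal.IsPrime.ne_top (Ideal.IsPrime.comap _)) ?_).symm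
  rw [Ideal.span_singleton_le_iff_mem, Ideal.mem_comap]
  simpa using hpQ

lemma ratPrimeSplits_of_jacobiSym_eq_one {K : Type*} [Field K] [NumberField K] {m : ℤ} {θ : 𝓞 K}
    (hθ : θ ^ 2 = (m : 𝓞 K)) (htr : Algebra.trace ℤ (𝓞 K) θ = 0)
    (hK : Module.finrank ℚ K = 2) {p : ℕ} (hp : p.Prime) (hp2 : p ≠ 2)
    (hJ : jacobiSym m p = 1) : RatPrimeSplits K p := by
  have := Fact.mk hp
  obtain ⟨r, hr⟩ := ZMod.isSquare_of_jacobiSym_eq_one hJ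
  obtain ⟨a, rfl⟩ := ZMod.intCast_surjective r
  have ha : (p : ℤ) ∣ m - a ^ 2 := by
    rw [← ZMod.intCast_zmod_eq_zero_iff_dvd]
    push_cast
    rw [hr]; ring
  have hpa : ¬ (p : ℤ) ∣ 2 * a := by
    intro h
    rcases (Nat.prime_iff_prime_int.mp hp).dvd_or_dvd h with h | h
    · exact hp2 ((Nat.prime_dvd_prime_iff_eq hp Nat.prime_two).mp (by exact_mod_cast h))
    · have hm : (p : ℤ) ∣ m := by
        have := dvd_add ha (h.trans (dvd_pow_self a two_ne_zero))
        simpa using this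
      have : jacobiSym m p = 0 := by
        rw [jacobiSym.eq_zero_iff_not_coprime]
        intro h1
        have := Int.dvd_coe_gcd hm (dvd_refl (p : ℤ))
        rw [h1] at this
        exact hp.one_lt.ne' (Nat.dvd_one.mp (by exact_mod_cast this))
      omega
  obtain ⟨Q₁, h₁, hp₁, hm₁⟩ := exists_maximal_ideal_mem hθ htr hK a ha hpa
  obtain ⟨Q₂, h₂, hp₂, hm₂⟩ := exists_maximal_ideal_mem hθ htr hK (-a) (by simpa using ha)
    (by simpa using hpa)
  have hbot : ∀ Q : Ideal (𝓞 K), (p : 𝓞 K) ∈ Q → Q ≠ ⊥ := by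
    rintro Q hQ rfl
    exact hp.ne_zero (by exact_mod_cast (Ideal.mem_bot.mp hQ))
  refine ⟨Q₁, Q₂, ?_, h₁.isPrime, h₂.isPrime, hbot _ hp₁, hbot _ hp₂,
    comap_eq_span_of_mem hp h₁ hp₁, comap_eq_span_of_mem hp h₂ hp₂⟩
  rintro rfl
  have h2a : ((2 * a : ℤ) : 𝓞 K) ∈ Q₁ := by
    have := Q₁.sub_mem hm₂ hm₁
    push_cast at this ⊢
    convert this using 1; ring
  have : 2 * a ∈ Q₁.comap (algebraMap ℤ (𝓞 K)) := by simpa [Ideal.mem_comap] using h2a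
  rw [comap_eq_span_of_mem hp h₁ hp₁, Ideal.mem_span_singleton] at this
  exact hpa this

lemma exists_int_eq_squarefree_mul_sq {k : ℤ} (hk : k ≠ 0) :
    ∃ (m : ℤ) (b : ℕ), Squarefree m ∧ b ≠ 0 ∧ k = m * b ^ 2 := by
  obtain ⟨a, b, hab, ha⟩ := Nat.sq_mul_squarefree k.natAbs
  have hb : b ≠ 0 := by
    rintro rfl
    simp at hab
    exact hk (Int.natAbs_eq_zero.mp hab.symm)
  refine ⟨k.sign * a, b, ?_, hb, ?_⟩
  · rw [← Int.squarefree_natAbs, Int.natAbs_mul, Int.natAbs_sign_of_ne_zero hk]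
    simpa using ha
  · have h := Int.sign_mul_natAbs k
    rw [← hab] at h
    push_cast at h
    linear_combination -h

lemma dvd_of_sq_dvd_sq_mul_squarefree {k c m : ℤ} (hm : Squarefree m) (hc : c ≠ 0)
    (h : k ^ 2 ∣ c ^ 2 * m) : k ∣ c := by
  obtain ⟨g, k', c', hg, hcop, rfl, rfl⟩ :=
    Int.exists_gcd_one' (m := k) (n := c) (Int.gcd_pos_of_ne_zero_right k hc)
  have hg0 : ((g : ℤ) ^ 2) ≠ 0 := by positivity
  rw [show (k' * (g : ℤ)) ^ 2 = g ^ 2 * k' ^ 2 by ring,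
    show (c' * (g : ℤ)) ^ 2 * m = g ^ 2 * (c' ^ 2 * m) by ring, mul_dvd_mul_iff_left hg0] at h
  have hu : IsUnit k' := hm k' (pow_two k' ▸
    ((Int.isCoprime_iff_gcd_eq_one.mpr hcop).pow (m := 2) (n := 2)).dvd_of_dvd_mul_left h)
  exact mul_dvd_mul hu.dvd dvd_rfl

lemma exists_sq_mem_range_of_finrank_eq_two {K : Type*} [Field K] [NumberField K]
    (hK : Module.finrank ℚ K = 2) :
    ∃ (θ : K) (q : ℚ), θ ∉ (algebraMap ℚ K).range ∧ θ ^ 2 = algebraMap ℚ K q := by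
  obtain ⟨α, hα⟩ : ∃ α : K, α ∉ (algebraMap ℚ K).range := by
    by_contra! h
    have : (⊥ : Subalgebra ℚ K) = ⊤ := by
      rw [eq_top_iff]
      intro x _
      exact Algebra.mem_bot.mpr (h x)
    have := Subalgebra.bot_eq_top_iff_finrank_eq_one.mp this
    omega
  have hinteg : IsIntegral ℚ α := Algebra.IsIntegral.isIntegral α
  have h1 : 2 ≤ (minpoly ℚ α).natDegree := (minpoly.two_le_natDegree_iff hinteg).mpr hα
  have h2 : (minpoly ℚ α).natDegree ≤ 2 := hK ▸ minpoly.natDegree_le α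
  have h3 : (minpoly ℚ α).natDegree = 2 := le_antisymm h2 h1
  have h4 := minpoly.aeval ℚ α
  have h5 : (minpoly ℚ α).coeff 2 = 1 := by
    have := (minpoly.monic hinteg).coeff_natDegree
    rwa [h3] at this
  rw [Polynomial.aeval_eq_sum_range, h3] at h4
  simp only [Finset.sum_range_succ, Finset.sum_range_zero, h5, Algebra.smul_def] at h4
  set b := (minpoly ℚ α).coeff 1
  set c := (minpoly ℚ α).coeff 0
  refine ⟨α + algebraMap ℚ K (b / 2), b ^ 2 / 4 - c, ?_, ?_⟩
  · intro h
    apply hα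
    have := Subring.sub_mem _ h (RingHom.mem_range_self (algebraMap ℚ K) (b / 2))
    simpa using this
  · simp only [map_sub, map_div₀, map_pow, map_ofNat, map_one] at h4 ⊢
    linear_combination h4

lemma exists_squarefree_sqrt {K : Type*} [Field K] [NumberField K]
    (hK : Module.finrank ℚ K = 2) :
    ∃ (m : ℤ) (θ : 𝓞 K), Squarefree m ∧ θ ^ 2 = (m : 𝓞 K) ∧
      (θ : K) ∉ (algebraMap ℚ K).range := by
  obtain ⟨θ₀, q, hθ₀, hq⟩ := exists_sq_mem_range_of_finrank_eq_two hK
  have hq0 : q ≠ 0 := by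
    rintro rfl
    apply hθ₀
    simp at hq
    simp [hq]
  have hk : q.num * q.den ≠ 0 := mul_ne_zero (Rat.num_ne_zero.mpr hq0) (by exact_mod_cast q.den_nz)
  obtain ⟨m, b, hm, hb, hkm⟩ := exists_int_eq_squarefree_mul_sq hk
  have hbK : (b : K) ≠ 0 := by exact_mod_cast hb
  have hdK : (q.den : K) ≠ 0 := by exact_mod_cast q.den_nz
  have hsq : (θ₀ * (q.den / b : ℚ)) ^ 2 = (m : K) := by
    have h1 : q * q.den ^ 2 = m * b ^ 2 := by
      have : (q.num * q.den : ℚ) = m * b ^ 2 := by exact_mod_cast hkm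
      rw [← this, pow_two, ← mul_assoc, Rat.mul_den_eq_num]
    have h2 : (q : K) * q.den ^ 2 = m * b ^ 2 := by exact_mod_cast congrArg (Rat.cast : ℚ → K) h1
    have hq' : θ₀ ^ 2 = (q : K) := by simpa using hq
    push_cast
    field_simp
    rw [hq', h2, mul_comm]
  have hinteg : IsIntegral ℤ (θ₀ * (q.den / b : ℚ)) := by
    refine IsIntegral.of_pow two_pos ?_
    rw [hsq]
    exact isIntegral_algebraMap (R := ℤ) (A := K) (x := m)
  obtain ⟨θ, hθ⟩ := IsIntegralClosure.isIntegral_iff (A := 𝓞 K) |>.mp hinteg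
  refine ⟨m, θ, hm, ?_, ?_⟩
  · apply RingOfIntegers.ext
    change algebraMap (𝓞 K) K _ = algebraMap (𝓞 K) K _
    rw [map_pow, hθ, hsq, map_intCast]
  · intro h
    apply hθ₀
    change algebraMap (𝓞 K) K _ ∈ _ at h
    rw [hθ] at h
    have h3 := Subring.mul_mem _ h (RingHom.mem_range_self (algebraMap ℚ K) (b / q.den))
    have h4 : θ₀ * (q.den / b : ℚ) * (algebraMap ℚ K (b / q.den)) = θ₀ := by
      simp
      field_simp
    exact h4 ▸ h3

lemma trace_eq_zero_of_sq_eq {K : Type*} [Field K] [NumberField K] {m : ℤ} {θ : 𝓞 K}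
    (hθ : θ ^ 2 = (m : 𝓞 K)) (hn : (θ : K) ∉ (algebraMap ℚ K).range) :
    Algebra.trace ℤ (𝓞 K) θ = 0 := by
  have hinteg : IsIntegral ℚ (θ : K) := Algebra.IsIntegral.isIntegral _
  have hsq : (θ : K) ^ 2 = m := by
    simpa only [map_pow, map_intCast] using congrArg (algebraMap (𝓞 K) K) hθ
  have h1 : 2 ≤ (minpoly ℚ (θ : K)).natDegree := (minpoly.two_le_natDegree_iff hinteg).mpr hn
  have hmon : (Polynomial.X ^ 2 - Polynomial.C (m : ℚ)).Monic :=
    Polynomial.monic_X_pow_sub_C _ two_ne_zero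
  have hmp : minpoly ℚ (θ : K) = Polynomial.X ^ 2 - Polynomial.C (m : ℚ) := by
    symm
    refine Polynomial.eq_of_monic_of_dvd_of_natDegree_le (minpoly.monic hinteg) hmon
      (minpoly.dvd _ _ (by simp [hsq])) ?_
    rw [Polynomial.natDegree_X_pow_sub_C]
    exact h1
  have := trace_eq_finrank_mul_minpoly_nextCoeff ℚ (θ : K)
  have hdeg : (Polynomial.X ^ 2 - Polynomial.C (m : ℚ)).natDegree = 2 :=
    Polynomial.natDegree_X_pow_sub_C
  rw [hmp, Polynomial.nextCoeff_of_natDegree_pos (by rw [hdeg]; exact two_pos), hdeg,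
    Polynomial.coeff_sub, Polynomial.coeff_X_pow, Polynomial.coeff_C] at this
  norm_num at this
  have h2 := Algebra.coe_trace_int θ
  rw [this] at h2
  exact_mod_cast h2

lemma abs_le_abs_discr {K : Type*} [Field K] [NumberField K] {m : ℤ} {θ : 𝓞 K}
    (hm : Squarefree m) (hθ : θ ^ 2 = (m : 𝓞 K)) (htr : Algebra.trace ℤ (𝓞 K) θ = 0)
    (hK : Module.finrank ℚ K = 2) : |m| ≤ |discr K| := by
  have h1 : Module.finrank ℤ (𝓞 K) = 2 := by rw [RingOfIntegers.rank, hK]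
  let b : Module.Basis (Fin 2) ℤ (𝓞 K) := Module.finBasisOfFinrankEq ℤ (𝓞 K) h1
  have h2 : Algebra.discr ℤ ![1, θ] = 4 * m := by
    have htc (k : ℤ) : Algebra.trace ℤ (𝓞 K) (k : 𝓞 K) = 2 * k := by
      have := Algebra.trace_algebraMap (S := 𝓞 K) k
      rw [h1] at this
      simpa using this
    have ht1 : Algebra.trace ℤ (𝓞 K) 1 = 2 := by simpa using htc 1
    rw [Algebra.discr_def, Matrix.det_fin_two]
    simp [Algebra.traceMatrix, Algebra.traceForm_apply, htr, ht1, ← pow_two, hθ, htc]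
    ring
  have h3 := Algebra.discr_of_matrix_vecMul b (b.toMatrix ![1, θ])
  rw [Module.Basis.toMatrix_map_vecMul, h2, discr_eq_discr] at h3
  set k := (b.toMatrix ![1, θ]).det
  have hk2 : k ∣ 2 := by
    refine dvd_of_sq_dvd_sq_mul_squarefree hm two_ne_zero ⟨discr K, ?_⟩
    linear_combination h3
  have hkle : k ^ 2 ≤ 4 := by
    have := sq_le_sq' (by linarith [neg_abs_le k, Int.le_of_dvd two_pos ((abs_dvd k 2).mpr hk2)])
      (Int.le_of_dvd two_pos hk2)
    simpa using this
  have h4 := congrArg abs h3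
  rw [abs_mul, abs_mul, abs_of_nonneg (sq_nonneg k)] at h4
  norm_num at h4
  nlinarith [abs_nonneg (discr K)]

/-- The quadratic field in `BadWitness` only enters through the Jacobi symbols of a squarefree
integer. -/
lemma exists_squarefree_of_badWitness {H : ℝ} {n : ℕ} {K : Type} [Field K] [NumberField K]
    (h : BadWitness H n K) :
    ∃ m : ℤ, Squarefree m ∧ m ≠ 1 ∧ (|m| : ℝ) ≤ H ∧
      ∀ p : ℕ, p.Prime → p ∣ n → jacobiSym (4 * m) p ≠ 1 := by
  obtain ⟨hK, hH, hsplit⟩ := h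
  obtain ⟨m, θ, hm, hθ, hn⟩ := exists_squarefree_sqrt hK
  have htr := trace_eq_zero_of_sq_eq hθ hn
  refine ⟨m, hm, ?_, ?_, ?_⟩
  · rintro rfl
    have : (θ - 1) * (θ + 1) = 0 := by linear_combination hθ + Int.cast_one (R := 𝓞 K)
    rcases mul_eq_zero.mp this with h | h
    · exact hn ⟨1, by rw [sub_eq_zero.mp h]; simp⟩
    · exact hn ⟨-1, by rw [eq_neg_of_add_eq_zero_left h]; simp⟩
  · refine le_trans ?_ hH
    exact_mod_cast abs_le_abs_discr hm hθ htr hK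
  · intro p hp hpn hJ
    rcases hp.eq_two_or_odd' with rfl | hodd
    · have : jacobiSym (4 * m) 2 = 0 := by
        rw [jacobiSym.eq_zero_iff_not_coprime, show (4 * m) = 2 * (2 * m) by ring]
        simp
      omega
    · rw [jacobiSym.mul_left, jacobiSym.at_four hodd, one_mul] at hJ
      exact hsplit p hp hpn
        (ratPrimeSplits_of_jacobiSym_eq_one hθ htr hK hp
          (by rintro rfl; exact absurd hodd (by decide)) hJ)

lemma sum_le_tsum_primes {f : ℕ → ℝ} (hf : ∀ p, 0 ≤ f p)
    (hs : Summable fun p : Nat.Primes => f p) (s : Finset ℕ) (hp : ∀ p ∈ s, p.Prime) :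
    ∑ p ∈ s, f p ≤ ∑' p : Nat.Primes, f p := by
  have hs' : Summable fun p : {p : ℕ // p.Prime} => f p := hs
  have h := hs'.sum_le_tsum (s.subtype Nat.Prime) fun p _ => hf p
  rwa [Finset.sum_subtype_of_mem f hp] at h

lemma summable_primes_of_le {σ C : ℝ} (hσ : 1 < σ) {f : ℕ → ℝ} (hf : ∀ p, |f p| ≤ C) :
    Summable fun p : Nat.Primes => f p * (p : ℝ) ^ (-σ) := by
  refine Summable.of_norm_bounded (g := fun p : Nat.Primes => C * (p : ℝ) ^ (-σ))
    ((Nat.Primes.summable_rpow.mpr (by linarith)).mul_left C) fun p => ?_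
  rw [Real.norm_eq_abs, abs_mul, abs_of_nonneg (Real.rpow_nonneg (Nat.cast_nonneg (p : ℕ)) _)]
  gcongr
  exact hf p

/-- The squarefree positive integers up to `x`. -/
noncomputable def squarefreeUpTo (x : ℝ) : Finset ℕ := {n ∈ Finset.Icc 1 ⌊x⌋₊ | Squarefree n}

lemma mem_squarefreeUpTo {x : ℝ} (hx : 0 ≤ x) {n : ℕ} :
    n ∈ squarefreeUpTo x ↔ 1 ≤ n ∧ (n : ℝ) ≤ x ∧ Squarefree n := by
  simp [squarefreeUpTo, Nat.le_floor_iff hx, and_assoc]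

lemma sum_squarefree_div_le {g : ℕ → ℝ} (hg0 : ∀ p, 0 ≤ g p) (hg2 : ∀ p, g p ≤ 2) {x : ℝ}
    (hx : 1 < x) :
    ∑ n ∈ squarefreeUpTo x, (∏ p ∈ n.primeFactors, g p) / n ≤
      Real.exp 1 * Real.exp (∑' p : Nat.Primes, g p * (p : ℝ) ^ (-(1 + 1 / Real.log x))) := by
  set σ := 1 + 1 / Real.log x with hσ
  have hl : 0 < Real.log x := Real.log_pos hx
  have hσ1 : 1 < σ := by rw [hσ]; linarith [one_div_pos.mpr hl]
  have hx0 : 0 ≤ x := by linarith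
  have h1 : ∀ n ∈ squarefreeUpTo x, (∏ p ∈ n.primeFactors, g p) / n ≤
      Real.exp 1 * ∏ p ∈ n.primeFactors, g p * (p : ℝ) ^ (-σ) := by
    intro n hn
    obtain ⟨hn1, hnx, hsq⟩ := (mem_squarefreeUpTo hx0).mp hn
    have hn0 : (0 : ℝ) < n := by exact_mod_cast hn1
    have hprod : ∏ p ∈ n.primeFactors, (p : ℝ) ^ (-σ) = (n : ℝ) ^ (-σ) := by
      rw [Real.finsetProd_rpow _ _ (fun p _ => Nat.cast_nonneg p), ← Nat.cast_prod,
        Nat.prod_primeFactors_of_squarefree hsq]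
    have hle : (n : ℝ)⁻¹ ≤ Real.exp 1 * (n : ℝ) ^ (-σ) := by
      rw [Real.rpow_neg hn0.le, ← div_eq_mul_inv, inv_eq_one_div,
        div_le_div_iff₀ hn0 (Real.rpow_pos_of_pos hn0 _), one_mul, hσ, Real.rpow_add hn0,
        Real.rpow_one, mul_comm]
      gcongr
      rw [Real.rpow_def_of_pos hn0]
      gcongr
      rw [mul_one_div, div_le_one hl]
      exact Real.log_le_log hn0 hnx
    rw [Finset.prod_mul_distrib, hprod, div_eq_mul_inv]
    calc _ ≤ (∏ p ∈ n.primeFactors, g p) * (Real.exp 1 * (n : ℝ) ^ (-σ)) := by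
          gcongr
          exact Finset.prod_nonneg fun p _ => hg0 p
      _ = _ := by ring
  have hnn : ∀ p : ℕ, 0 ≤ g p * (p : ℝ) ^ (-σ) := fun p =>
    mul_nonneg (hg0 p) (Real.rpow_nonneg (Nat.cast_nonneg p) _)
  set P := (Finset.Icc 1 ⌊x⌋₊).filter Nat.Prime
  have hinj : Set.InjOn Nat.primeFactors (squarefreeUpTo x) := by
    intro a ha b hb hab
    rw [← Nat.prod_primeFactors_of_squarefree ((mem_squarefreeUpTo hx0).mp ha).2.2, hab,
      Nat.prod_primeFactors_of_squarefree ((mem_squarefreeUpTo hx0).mp hb).2.2]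
  have h2 : ∑ n ∈ squarefreeUpTo x, ∏ p ∈ n.primeFactors, g p * (p : ℝ) ^ (-σ) ≤
      ∏ p ∈ P, (1 + g p * (p : ℝ) ^ (-σ)) := by
    rw [Finset.prod_one_add, ← Finset.sum_image (f := fun t => ∏ p ∈ t, g p * (p : ℝ) ^ (-σ)) hinj]
    refine Finset.sum_le_sum_of_subset_of_nonneg ?_ fun t _ _ => Finset.prod_nonneg fun p _ => hnn p
    intro t ht
    obtain ⟨n, hn, rfl⟩ := Finset.mem_image.mp ht
    obtain ⟨hn1, hnx, hsq⟩ := (mem_squarefreeUpTo hx0).mp hn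
    rw [Finset.mem_powerset]
    intro p hp
    have hp' := Nat.prime_of_mem_primeFactors hp
    simp only [P, Finset.mem_filter, Finset.mem_Icc]
    exact ⟨⟨hp'.one_lt.le, (Nat.le_of_dvd hn1 (Nat.dvd_of_mem_primeFactors hp)).trans
      ((Nat.le_floor_iff hx0).mpr hnx)⟩, hp'⟩
  have h3 : ∏ p ∈ P, (1 + g p * (p : ℝ) ^ (-σ)) ≤
      Real.exp (∑' p : Nat.Primes, g p * (p : ℝ) ^ (-σ)) := by
    calc _ ≤ ∏ p ∈ P, Real.exp (g p * (p : ℝ) ^ (-σ)) := by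
          refine Finset.prod_le_prod (fun p _ => by linarith [hnn p]) fun p _ => ?_
          linarith [Real.add_one_le_exp (g p * (p : ℝ) ^ (-σ))]
      _ = Real.exp (∑ p ∈ P, g p * (p : ℝ) ^ (-σ)) := (Real.exp_sum _ _).symm
      _ ≤ _ := by
        gcongr
        refine sum_le_tsum_primes (f := fun p => g p * (p : ℝ) ^ (-σ)) hnn
          (summable_primes_of_le (C := 2) hσ1 fun p => ?_) P fun p hp => (Finset.mem_filter.mp hp).2
        rw [abs_of_nonneg (hg0 p)]
        exact hg2 p
  calc _ ≤ ∑ n ∈ squarefreeUpTo x, Real.exp 1 * ∏ p ∈ n.primeFactors, g p * (p : ℝ) ^ (-σ) :=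
        Finset.sum_le_sum h1
    _ = Real.exp 1 * ∑ n ∈ squarefreeUpTo x, ∏ p ∈ n.primeFactors, g p * (p : ℝ) ^ (-σ) := by
        rw [Finset.mul_sum]
    _ ≤ _ := by gcongr; exact h2.trans h3

lemma prod_primeFactors_mul_of_squarefree {g : ℕ → ℝ} {n p : ℕ} (hn : Squarefree n)
    (hp : p ∈ n.primeFactors) :
    ∏ q ∈ n.primeFactors, g q = g p * ∏ q ∈ (n / p).primeFactors, g q := by
  obtain ⟨m, rfl⟩ := Nat.dvd_of_mem_primeFactors hp
  have hp' := Nat.prime_of_mem_primeFactors hp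
  have hcop : p.Coprime m := (Nat.squarefree_mul_iff.mp hn).1
  rw [Nat.mul_div_cancel_left _ hp'.pos, hcop.primeFactors_mul,
    Finset.prod_union hcop.disjoint_primeFactors, hp'.primeFactors, Finset.prod_singleton]

lemma sum_squarefree_mul_log_le {g : ℕ → ℝ} (hg0 : ∀ p, 0 ≤ g p) (hg2 : ∀ p, g p ≤ 2) {x : ℝ}
    (hx : 1 < x) :
    ∑ n ∈ squarefreeUpTo x, (∏ p ∈ n.primeFactors, g p) * Real.log n ≤
      2 * Real.log 4 * x * ∑ n ∈ squarefreeUpTo x, (∏ p ∈ n.primeFactors, g p) / n := by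
  have hx0 : 0 ≤ x := by linarith
  set F : ℕ → ℝ := fun n => ∏ p ∈ n.primeFactors, g p with hF
  have hF0 : ∀ n, 0 ≤ F n := fun n => Finset.prod_nonneg fun p _ => hg0 p
  set P := (Finset.Icc 1 ⌊x⌋₊).filter Nat.Prime with hP
  have h1 : ∀ n ∈ squarefreeUpTo x, F n * Real.log n =
      ∑ p ∈ P with p ∣ n, g p * Real.log p * F (n / p) := by
    intro n hn
    obtain ⟨hn1, hnx, hsq⟩ := (mem_squarefreeUpTo hx0).mp hn
    have hPn : {p ∈ P | p ∣ n} = n.primeFactors := by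
      ext p
      simp only [hP, Finset.mem_filter, Finset.mem_Icc, Nat.mem_primeFactors]
      constructor
      · rintro ⟨⟨-, h⟩, h'⟩
        exact ⟨h, h', by omega⟩
      · rintro ⟨h, h', -⟩
        exact ⟨⟨⟨h.one_lt.le, (Nat.le_of_dvd hn1 h').trans ((Nat.le_floor_iff hx0).mpr hnx)⟩, h⟩,
          h'⟩
    rw [hPn]
    have hlog : Real.log n = ∑ p ∈ n.primeFactors, Real.log p := by
      rw [← Real.log_prod, ← Nat.cast_prod, Nat.prod_primeFactors_of_squarefree hsq]
      intro p hp
      exact_mod_cast (Nat.prime_of_mem_primeFactors hp).ne_zero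
    rw [hlog, Finset.mul_sum]
    · refine Finset.sum_congr rfl fun p hp => ?_
      simp only [hF]
      rw [prod_primeFactors_mul_of_squarefree hsq hp]
      ring
  have h2 : ∀ p ∈ P, ∑ n ∈ squarefreeUpTo x with p ∣ n, g p * Real.log p * F (n / p) ≤
      ∑ m ∈ squarefreeUpTo x with (p : ℝ) ≤ x / (m : ℕ), 2 * Real.log p * F m := by
    intro p hp
    have hpp : p.Prime := (Finset.mem_filter.mp hp).2
    have hlp : 0 ≤ Real.log p := Real.log_natCast_nonneg p
    have hinj : Set.InjOn (fun n => n / p) ({n ∈ squarefreeUpTo x | p ∣ n} : Finset ℕ) := by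
      intro a ha b hb hab
      have ha' := (Finset.mem_filter.mp ha).2
      have hb' := (Finset.mem_filter.mp hb).2
      simp only at hab
      rw [← Nat.div_mul_cancel ha', hab, Nat.div_mul_cancel hb']
    rw [← Finset.sum_image (f := fun m => g p * Real.log p * F m) hinj]
    calc _ ≤ ∑ m ∈ squarefreeUpTo x with (p : ℝ) ≤ x / (m : ℕ), g p * Real.log p * F m := by
          refine Finset.sum_le_sum_of_subset_of_nonneg ?_ fun m _ _ =>
            mul_nonneg (mul_nonneg (hg0 p) hlp) (hF0 m)
          intro m hm
          obtain ⟨n, hn, rfl⟩ := Finset.mem_image.mp hm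
          obtain ⟨hn, k, rfl⟩ := Finset.mem_filter.mp hn
          obtain ⟨hn1, hnx, hsq⟩ := (mem_squarefreeUpTo hx0).mp hn
          simp only [Nat.mul_div_cancel_left _ hpp.pos]
          have hk : 1 ≤ k := Nat.pos_of_mul_pos_left hn1
          have hk' : (0 : ℝ) < k := by exact_mod_cast hk
          push_cast at hnx
          have hp1 : (1 : ℝ) ≤ p := by exact_mod_cast hpp.one_lt.le
          rw [Finset.mem_filter, mem_squarefreeUpTo hx0, le_div_iff₀ hk']
          exact ⟨⟨hk, by nlinarith, hsq.of_mul_right⟩, hnx⟩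
      _ ≤ _ := by
          gcongr with m _
          · exact hF0 m
          · exact hg2 p
  calc ∑ n ∈ squarefreeUpTo x, F n * Real.log n
      = ∑ n ∈ squarefreeUpTo x, ∑ p ∈ P with p ∣ n, g p * Real.log p * F (n / p) :=
        Finset.sum_congr rfl h1
    _ = ∑ p ∈ P, ∑ n ∈ squarefreeUpTo x with p ∣ n, g p * Real.log p * F (n / p) := by
        simp only [Finset.sum_filter]
        exact Finset.sum_comm
    _ ≤ ∑ p ∈ P, ∑ m ∈ squarefreeUpTo x with (p : ℝ) ≤ x / (m : ℕ), 2 * Real.log p * F m :=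
        Finset.sum_le_sum h2
    _ = ∑ m ∈ squarefreeUpTo x, ∑ p ∈ P with ((p : ℕ) : ℝ) ≤ x / m, 2 * Real.log p * F m := by
        simp only [Finset.sum_filter]
        exact Finset.sum_comm
    _ ≤ ∑ m ∈ squarefreeUpTo x, 2 * Real.log 4 * x * (F m / m) := by
        refine Finset.sum_le_sum fun m hm => ?_
        obtain ⟨hm1, hmx, hsq⟩ := (mem_squarefreeUpTo hx0).mp hm
        have hm0 : (0 : ℝ) < m := by exact_mod_cast hm1
        have hth : ∑ p ∈ P with ((p : ℕ) : ℝ) ≤ x / m, Real.log p ≤ Real.log 4 * (x / m) := by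
          refine le_trans ?_ (Chebyshev.theta_le_log4_mul_x (by positivity))
          rw [Chebyshev.theta_eq_sum_Icc]
          refine Finset.sum_le_sum_of_subset_of_nonneg ?_ fun p _ _ => Real.log_natCast_nonneg p
          intro p hp
          obtain ⟨hp, hpx⟩ := Finset.mem_filter.mp hp
          have hpp := (Finset.mem_filter.mp hp).2
          simp only [Finset.mem_filter, Finset.mem_Icc]
          exact ⟨⟨Nat.zero_le _, (Nat.le_floor_iff (by positivity)).mpr hpx⟩, hpp⟩
        rw [← Finset.sum_mul, ← Finset.mul_sum]
        calc _ ≤ 2 * (Real.log 4 * (x / m)) * F m := by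
              gcongr
              exact hF0 m
          _ = _ := by ring
    _ = _ := by rw [Finset.mul_sum]

/-- An upper bound of the correct order of magnitude for the mean value of a multiplicative
function supported on squarefree integers. -/
lemma sum_squarefree_le {g : ℕ → ℝ} (hg0 : ∀ p, 0 ≤ g p) (hg2 : ∀ p, g p ≤ 2) {x : ℝ}
    (hx : 1 < x) :
    ∑ n ∈ squarefreeUpTo x, ∏ p ∈ n.primeFactors, g p ≤
      12 * (x / Real.log x) *
        Real.exp (∑' p : Nat.Primes, g p * (p : ℝ) ^ (-(1 + 1 / Real.log x))) := by
  have hx0 : 0 < x := by linarith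
  have hl : 0 < Real.log x := Real.log_pos hx
  set F : ℕ → ℝ := fun n => ∏ p ∈ n.primeFactors, g p with hF
  have hF0 : ∀ n, 0 ≤ F n := fun n => Finset.prod_nonneg fun p _ => hg0 p
  set E := Real.exp (∑' p : Nat.Primes, g p * (p : ℝ) ^ (-(1 + 1 / Real.log x)))
  have h1 : (∑ n ∈ squarefreeUpTo x, F n) * Real.log x ≤
      ∑ n ∈ squarefreeUpTo x, F n * Real.log n + x * ∑ n ∈ squarefreeUpTo x, F n / n := by
    rw [Finset.sum_mul, Finset.mul_sum, ← Finset.sum_add_distrib]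
    refine Finset.sum_le_sum fun n hn => ?_
    obtain ⟨hn1, hnx, hsq⟩ := (mem_squarefreeUpTo hx0.le).mp hn
    have hn0 : (0 : ℝ) < n := by exact_mod_cast hn1
    have h2 := Real.log_le_sub_one_of_pos (div_pos hx0 hn0)
    rw [Real.log_div hx0.ne' hn0.ne'] at h2
    have h3 : F n * Real.log x ≤ F n * (Real.log n + x / n) := by
      gcongr
      · exact hF0 n
      · linarith
    calc _ ≤ _ := h3
      _ = _ := by ring
  have h2 := sum_squarefree_mul_log_le hg0 hg2 hx
  have h3 := sum_squarefree_div_le hg0 hg2 hx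
  have h4 : Real.log 4 < 1.4 := by
    rw [show (4 : ℝ) = 2 ^ 2 by norm_num, Real.log_pow]
    have := Real.log_two_lt_d9
    norm_num at this ⊢
    linarith
  have h5 : 0 ≤ ∑ n ∈ squarefreeUpTo x, F n / n :=
    Finset.sum_nonneg fun n _ => div_nonneg (hF0 n) (Nat.cast_nonneg n)
  have h6 : (∑ n ∈ squarefreeUpTo x, F n) * Real.log x ≤ 12 * x * E := by
    calc _ ≤ (2 * Real.log 4 + 1) * x * ∑ n ∈ squarefreeUpTo x, F n / n := by linarith
      _ ≤ 3.8 * x * (Real.exp 1 * E) := by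
        gcongr
        linarith
      _ ≤ 3.8 * x * (2.72 * E) := by
        gcongr
        have := Real.exp_one_lt_d9
        linarith
      _ ≤ _ := by
        have : 0 ≤ x * E := by positivity
        linarith
  rw [← le_div_iff₀ hl] at h6
  calc _ ≤ _ := h6
    _ = _ := by ring

/-- A real, completely multiplicative, `q`-periodic function, nontrivial on the units mod `q`. -/
structure IsRealChar (f : ℕ →*₀ ℝ) (q : ℕ) : Prop where
  pos : 0 < q
  values : ∀ n, f n = 0 ∨ f n = 1 ∨ f n = -1
  periodic : Function.Periodic f q
  exists_eq_neg_one : ∃ n : ℕ, n.Coprime q ∧ f n = -1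

namespace IsRealChar

variable {f : ℕ →*₀ ℝ} {q : ℕ}

lemma abs_le_one (hf : IsRealChar f q) (n : ℕ) : |f n| ≤ 1 := by
  rcases hf.values n with h | h | h <;> simp [h]

lemma sum_period (hf : IsRealChar f q) : ∑ n ∈ Finset.range q, f n = 0 := by
  have : NeZero q := ⟨hf.pos.ne'⟩
  obtain ⟨n, hn, hfn⟩ := hf.exists_eq_neg_one
  have hsum : ∑ n ∈ Finset.range q, f n = ∑ a : ZMod q, f a.val :=
    Finset.sum_nbij' (fun n => (n : ZMod q)) ZMod.val (by simp) (by simp [ZMod.val_lt])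
      (fun a ha => ZMod.val_cast_of_lt (Finset.mem_range.mp ha)) (by simp)
      fun a ha => by rw [ZMod.val_cast_of_lt (Finset.mem_range.mp ha)]
  have hmul : ∑ a : ZMod q, f a.val = ∑ a : ZMod q, f n * f a.val := by
    refine (Fintype.sum_equiv (Units.mulLeft (ZMod.unitOfCoprime n hn)) _ _ fun a => ?_).symm
    rw [Units.mulLeft_apply, ZMod.coe_unitOfCoprime, ZMod.val_mul, hf.periodic.map_mod_nat, map_mul,
      ZMod.val_natCast, hf.periodic.map_mod_nat]
  rw [← Finset.mul_sum, hfn] at hmul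
  rw [hsum]
  linarith

lemma abs_sum_range_le (hf : IsRealChar f q) (N : ℕ) : |∑ n ∈ Finset.range N, f n| ≤ q := by
  induction N using Nat.strong_induction_on with
  | _ N ih =>
    rcases lt_or_ge N q with h | h
    · calc _ ≤ ∑ n ∈ Finset.range N, |f n| := Finset.abs_sum_le_sum_abs _ _
        _ ≤ ∑ n ∈ Finset.range N, (1 : ℝ) := Finset.sum_le_sum fun n _ => hf.abs_le_one n
        _ ≤ q := by simpa using h.le
    · obtain ⟨k, rfl⟩ := Nat.exists_eq_add_of_le h
      rw [Finset.sum_range_add, hf.sum_period, zero_add]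
      simp only [add_comm q, hf.periodic _]
      exact ih k (by have := hf.pos; omega)

lemma abs_sum_range_succ_le (hf : IsRealChar f q) (N : ℕ) :
    |∑ n ∈ Finset.range N, f (n + 1)| ≤ q := by
  have := hf.abs_sum_range_le (N + 1)
  rwa [Finset.sum_range_succ', map_zero, add_zero] at this

end IsRealChar

lemma abs_sum_mul_le_of_antitone {b c : ℕ → ℝ} {Q : ℝ} (hb : Antitone b) (hb0 : ∀ n, 0 ≤ b n)
    (hc : ∀ N, |∑ n ∈ Finset.range N, c n| ≤ Q) (N : ℕ) :
    |∑ n ∈ Finset.range N, c n * b n| ≤ Q * b 0 := by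
  have h1 : ∑ n ∈ Finset.range N, c n * b n = b N * ∑ n ∈ Finset.range N, c n +
      ∑ n ∈ Finset.range N, (b n - b (n + 1)) * ∑ i ∈ Finset.range (n + 1), c i := by
    induction N with
    | zero => simp
    | succ N ih =>
      rw [Finset.sum_range_succ, ih, Finset.sum_range_succ (fun n => (b n - b (n + 1)) * _) N]
      simp only [Finset.sum_range_succ c]
      ring
  rw [h1]
  calc _ ≤ |b N * ∑ n ∈ Finset.range N, c n| +
        ∑ n ∈ Finset.range N, |(b n - b (n + 1)) * ∑ i ∈ Finset.range (n + 1), c i| :=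
        (abs_add_le _ _).trans (by gcongr; exact Finset.abs_sum_le_sum_abs _ _)
    _ ≤ b N * Q + ∑ n ∈ Finset.range N, (b n - b (n + 1)) * Q := by
        simp only [abs_mul, abs_of_nonneg (hb0 N),
          abs_of_nonneg (sub_nonneg.mpr (hb (Nat.le_succ _)))]
        gcongr with n
        · exact hb0 N
        · exact hc N
        · exact sub_nonneg.mpr (hb (Nat.le_succ _))
        · exact hc _
    _ = _ := by
        rw [← Finset.sum_mul, Finset.sum_range_sub']
        ring

lemma natCast_mul_pow_le_mul_sum {u : ℝ} (hu : 0 ≤ u) (n : ℕ) :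
    n * u ^ n ≤ u * ∑ i ∈ Finset.range n, (u ^ 2) ^ i := by
  induction n using Nat.twoStepInduction with
  | zero => simp
  | one => simp
  | more n ih _ =>
    rw [Finset.sum_range_succ', Finset.sum_range_succ]
    have h : ∑ i ∈ Finset.range n, (u ^ 2) ^ (i + 1) =
        u ^ 2 * ∑ i ∈ Finset.range n, (u ^ 2) ^ i := by
      rw [Finset.mul_sum]
      exact Finset.sum_congr rfl fun i _ => by ring
    rw [h]
    have h2 : 0 ≤ u * (1 - u ^ (n + 1)) ^ 2 := by positivity
    have h3 := mul_le_mul_of_nonneg_left ih (sq_nonneg u)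
    have h4 : (u ^ 2) ^ (n + 1) = (u ^ (n + 1)) ^ 2 := by ring
    rw [h4]
    push_cast
    have h5 : u ^ (n + 2) = u * u ^ (n + 1) := by ring
    have h6 : u ^ 2 * (n * u ^ n) = n * (u * u ^ (n + 1)) := by ring
    rw [h5]
    rw [h6] at h3
    nlinarith

lemma mul_pow_le_sum_mul_sum {t : ℝ} (ht : 0 < t) (ht1 : t ≤ 1) (n : ℕ) :
    n * (n + 1) * t ^ n ≤
      (∑ i ∈ Finset.range n, t ^ i) * ∑ i ∈ Finset.range (n + 1), t ^ i := by
  obtain ⟨u, hu, rfl⟩ : ∃ u : ℝ, 0 < u ∧ t = u ^ 2 :=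
    ⟨√t, Real.sqrt_pos.mpr ht, (Real.sq_sqrt ht.le).symm⟩
  have hu1 : u ≤ 1 := by nlinarith
  have h1 := natCast_mul_pow_le_mul_sum hu.le n
  have h2 := natCast_mul_pow_le_mul_sum hu.le (n + 1)
  have h3 := mul_le_mul h1 h2 (by positivity) (by positivity)
  have h4 : u ^ (2 * n + 2) ≤ u ^ (2 * n + 1) := pow_le_pow_of_le_one hu.le hu1 (by omega)
  have h5 : (n * (n + 1) : ℝ) * u ^ (2 * n + 2) ≤ n * (n + 1) * u ^ (2 * n + 1) := by gcongr
  refine le_of_mul_le_mul_left ?_ (show 0 < u ^ 2 by positivity)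
  calc _ = (n * (n + 1) : ℝ) * u ^ (2 * n + 2) := by ring
    _ ≤ _ := h5
    _ = n * u ^ n * (((n + 1 : ℕ) : ℝ) * u ^ (n + 1)) := by push_cast; ring
    _ ≤ _ := h3
    _ = _ := by ring

lemma antitone_inv_sub_geom {t : ℝ} (ht : 0 < t) (ht1 : t < 1) :
    Antitone fun n : ℕ => ((n + 1 : ℕ) : ℝ)⁻¹ - (1 - t) * (t ^ (n + 1) / (1 - t ^ (n + 1))) := by
  refine antitone_nat_of_succ_le fun n => ?_
  have hs := mul_pow_le_sum_mul_sum ht ht1.le (n + 1)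
  have hg : ∀ m : ℕ, 1 - t ^ m = (1 - t) * ∑ i ∈ Finset.range m, t ^ i := fun m => by
    rw [mul_comm, geom_sum_mul_neg]
  have hpos : ∀ m : ℕ, 0 < ∑ i ∈ Finset.range (m + 1), t ^ i := fun m =>
    Finset.sum_pos (fun i _ => by positivity) (by simp)
  have ht' : 0 < 1 - t := by linarith
  have key : ∀ m : ℕ, (1 - t) * (t ^ (m + 1) / (1 - t ^ (m + 1))) =
      t ^ (m + 1) / ∑ i ∈ Finset.range (m + 1), t ^ i := fun m => by
    rw [hg]
    have := (hpos m).ne'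
    field_simp
  rw [key, key]
  have h1 := hpos n
  have h2 := hpos (n + 1)
  set A := ∑ i ∈ Finset.range (n + 1), t ^ i with hA
  have hB : ∑ i ∈ Finset.range (n + 1 + 1), t ^ i = A + t ^ (n + 1) := Finset.sum_range_succ _ _
  have hB' : A + t ^ (n + 1) = t * A + 1 := by
    rw [← hB, Finset.sum_range_succ', hA, Finset.mul_sum]
    simp [pow_succ']
  rw [hB] at hs h2 ⊢
  have e1 : t ^ (n + 1) / A - t ^ (n + 1 + 1) / (A + t ^ (n + 1)) =
      t ^ (n + 1) / (A * (A + t ^ (n + 1))) := by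
    rw [div_sub_div _ _ h1.ne' h2.ne']
    congr 1
    rw [pow_succ t (n + 1)]
    linear_combination t ^ (n + 1) * hB'
  have e2 : ((n + 1 : ℕ) : ℝ)⁻¹ - ((n + 1 + 1 : ℕ) : ℝ)⁻¹ =
      1 / (((n + 1 : ℕ) : ℝ) * (((n + 1 : ℕ) : ℝ) + 1)) := by
    push_cast
    field_simp
    ring
  have e3 : t ^ (n + 1) / (A * (A + t ^ (n + 1))) ≤
      1 / (((n + 1 : ℕ) : ℝ) * (((n + 1 : ℕ) : ℝ) + 1)) := by
    rw [div_le_div_iff₀ (by positivity) (by positivity)]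
    linarith
  linarith

lemma inv_sub_geom_nonneg {t : ℝ} (ht : 0 < t) (ht1 : t < 1) (n : ℕ) :
    0 ≤ ((n + 1 : ℕ) : ℝ)⁻¹ - (1 - t) * (t ^ (n + 1) / (1 - t ^ (n + 1))) := by
  have h1 : 0 < 1 - t ^ (n + 1) := sub_pos.mpr (pow_lt_one₀ ht.le ht1 (by omega))
  have h2 : ((n + 1 : ℕ) : ℝ) * t ^ (n + 1) ≤ ∑ i ∈ Finset.range (n + 1), t ^ i := by
    calc _ = ∑ i ∈ Finset.range (n + 1), t ^ (n + 1) := by simp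
      _ ≤ _ := Finset.sum_le_sum fun i hi =>
        pow_le_pow_of_le_one ht.le ht1.le (Finset.mem_range.mp hi).le
  have h3 := geom_sum_mul_neg t (n + 1)
  rw [sub_nonneg, ← mul_div_assoc, div_le_iff₀ h1, inv_mul_eq_div, le_div_iff₀ (by positivity)]
  have h4 : 0 < 1 - t := by linarith
  rw [← h3]
  nlinarith

lemma antitone_mul_inv_sub_rpow {σ : ℝ} (hσ : 1 ≤ σ) :
    Antitone fun n : ℕ => σ * ((n + 1 : ℕ) : ℝ)⁻¹ - ((n + 1 : ℕ) : ℝ) ^ (-σ) := by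
  refine antitone_nat_of_succ_le fun n => ?_
  set v := ((n + 1 : ℕ) : ℝ)⁻¹ with hv
  set w := ((n + 1 + 1 : ℕ) : ℝ)⁻¹ with hw
  have hv0 : 0 < v := by positivity
  have hw0 : 0 < w := by positivity
  have hv1 : v ≤ 1 := inv_le_one_of_one_le₀ (by exact_mod_cast Nat.succ_pos n)
  have hwv : w ≤ v := by
    rw [hv, hw]
    gcongr
    omega
  rw [Real.rpow_neg (by positivity), Real.rpow_neg (by positivity),
    ← Real.inv_rpow (by positivity), ← Real.inv_rpow (by positivity)]
  have h1 := one_add_mul_self_le_rpow_one_add (s := w / v - 1) (by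
    have : 0 ≤ w / v := by positivity
    linarith) hσ
  rw [add_sub_cancel, Real.div_rpow hw0.le hv0.le, le_div_iff₀ (by positivity)] at h1
  have h2 : v ^ σ ≤ v := by
    simpa using Real.rpow_le_rpow_of_exponent_ge hv0 hv1 hσ
  have h3 : (1 - w / v) * v ^ σ ≤ (1 - w / v) * v := by
    gcongr
    rw [sub_nonneg, div_le_one hv0]
    exact hwv
  have h4 : (1 - w / v) * v = v - w := by field_simp
  have h5 : σ * ((1 - w / v) * v ^ σ) ≤ σ * (v - w) := by
    rw [← h4]
    gcongr
  change σ * w - w ^ σ ≤ σ * v - v ^ σ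
  linarith

lemma mul_inv_sub_rpow_nonneg {σ : ℝ} (hσ : 1 ≤ σ) (n : ℕ) :
    0 ≤ σ * ((n + 1 : ℕ) : ℝ)⁻¹ - ((n + 1 : ℕ) : ℝ) ^ (-σ) := by
  have h1 : (1 : ℝ) ≤ ((n + 1 : ℕ) : ℝ) := by exact_mod_cast Nat.succ_pos n
  have h2 : ((n + 1 : ℕ) : ℝ) ^ (-σ) ≤ ((n + 1 : ℕ) : ℝ)⁻¹ := by
    rw [← Real.rpow_neg_one]
    exact Real.rpow_le_rpow_of_exponent_le h1 (by linarith)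
  have h3 : 1 * ((n + 1 : ℕ) : ℝ)⁻¹ ≤ σ * ((n + 1 : ℕ) : ℝ)⁻¹ := by gcongr
  linarith

lemma summable_rpow_neg {σ : ℝ} (hσ : 1 < σ) : Summable fun n : ℕ => (n : ℝ) ^ (-σ) :=
  Real.summable_nat_rpow.mpr (by linarith)

/-- The completely multiplicative function `n ↦ n ^ (-σ)`. -/
noncomputable def rpowNegHom {σ : ℝ} (hσ : 1 < σ) : ℕ →*₀ ℝ where
  toFun n := (n : ℝ) ^ (-σ)
  map_zero' := by simp [Real.zero_rpow (show -σ ≠ 0 by linarith)]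
  map_one' := by simp
  map_mul' m n := by
    push_cast
    exact Real.mul_rpow (Nat.cast_nonneg m) (Nat.cast_nonneg n)

lemma exp_le_inv_one_sub {t : ℝ} (ht : t < 1) : Real.exp t ≤ (1 - t)⁻¹ := by
  rw [le_inv_comm₀ (Real.exp_pos t) (by linarith), ← Real.exp_neg]
  linarith [Real.add_one_le_exp (-t)]

lemma inv_one_sub_le_exp {t : ℝ} (ht : |t| ≤ 1 / 2) : (1 - t)⁻¹ ≤ Real.exp (t + t ^ 2) := by
  obtain ⟨h1, h2⟩ := abs_le.mp ht
  rw [inv_le_iff_one_le_mul₀' (by linarith)]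
  rcases le_total t 0 with ht0 | ht0
  · have h3 := mul_le_mul_of_nonneg_left (Real.add_one_le_exp (t + t ^ 2))
      (show 0 ≤ 1 - t by linarith)
    nlinarith [mul_nonneg (sq_nonneg t) (neg_nonneg.mpr ht0)]
  · have h3 := mul_le_mul_of_nonneg_left
      (Real.quadratic_le_exp_of_nonneg (show 0 ≤ t + t ^ 2 by positivity))
      (show 0 ≤ 1 - t by linarith)
    have h4 : 0 ≤ t ^ 2 * (1 / 2 - t) := mul_nonneg (sq_nonneg t) (by linarith)
    have h5 : 0 ≤ t ^ 3 := by positivity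
    nlinarith [mul_nonneg h5 (show 0 ≤ 1 / 2 - t by linarith), mul_nonneg (sq_nonneg t) h5]

lemma summable_primes_inv_sq : Summable fun p : Nat.Primes => ((p : ℝ) ^ 2)⁻¹ := by
  have := Nat.Primes.summable_rpow (r := -2) |>.mpr (by norm_num)
  refine this.congr fun p => ?_
  rw [Real.rpow_neg (Nat.cast_nonneg _)]
  norm_cast

section EulerProduct

variable {F : ℕ →*₀ ℝ} {σ : ℝ}

lemma rpow_neg_le_half {σ : ℝ} (hσ : 1 < σ) (p : Nat.Primes) : (p : ℝ) ^ (-σ) ≤ 1 / 2 := by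
  have h2 : (2 : ℝ) ≤ p := by exact_mod_cast p.2.two_le
  calc (p : ℝ) ^ (-σ) ≤ (p : ℝ) ^ (-1 : ℝ) :=
        Real.rpow_le_rpow_of_exponent_le (by linarith) (by linarith)
    _ = (p : ℝ)⁻¹ := Real.rpow_neg_one _
    _ ≤ 1 / 2 := by rw [one_div]; gcongr

lemma hasProd_euler (hσ : 1 < σ) (hF : ∀ n, |F n| ≤ (n : ℝ) ^ (-σ)) :
    HasProd (fun p : Nat.Primes => (1 - F p)⁻¹) (∑' n, F n) :=
  EulerProduct.eulerProduct_completely_multiplicative_hasProd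
    (Summable.of_nonneg_of_le (fun _ => norm_nonneg _) hF (summable_rpow_neg hσ))

lemma summable_primes_of_abs_le (hσ : 1 < σ) (hF : ∀ n, |F n| ≤ (n : ℝ) ^ (-σ)) :
    Summable fun p : Nat.Primes => F p :=
  Summable.of_norm_bounded (Nat.Primes.summable_rpow.mpr (by linarith)) fun p : Nat.Primes => hF p

lemma exp_tsum_primes_le (hσ : 1 < σ) (hF : ∀ n, |F n| ≤ (n : ℝ) ^ (-σ)) :
    Real.exp (∑' p : Nat.Primes, F p) ≤ ∑' n, F n := by
  have h1 := (Real.continuous_exp.tendsto _).comp (summable_primes_of_abs_le hσ hF).hasSum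
  refine le_of_tendsto_of_tendsto' h1 (hasProd_euler hσ hF) fun s => ?_
  simp only [Function.comp_apply, Real.exp_sum]
  refine Finset.prod_le_prod (fun _ _ => (Real.exp_pos _).le) fun p _ => exp_le_inv_one_sub ?_
  linarith [le_abs_self (F p), hF p, rpow_neg_le_half hσ p]

lemma tsum_le_exp_tsum_primes (hσ : 1 < σ) (hF : ∀ n, |F n| ≤ (n : ℝ) ^ (-σ)) :
    ∑' n, F n ≤ Real.exp (∑' p : Nat.Primes, F p + ∑' p : Nat.Primes, ((p : ℝ) ^ 2)⁻¹) := by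
  have h1 := (Real.continuous_exp.tendsto _).comp
    ((summable_primes_of_abs_le hσ hF).hasSum.add summable_primes_inv_sq.hasSum)
  refine le_of_tendsto_of_tendsto' (hasProd_euler hσ hF) h1 fun s => ?_
  simp only [Function.comp_apply, Real.exp_sum]
  refine Finset.prod_le_prod (fun p _ => ?_) fun p _ => ?_
  · rw [inv_nonneg]
    linarith [le_abs_self (F p), hF p, rpow_neg_le_half hσ p]
  · refine (inv_one_sub_le_exp ((hF p).trans (rpow_neg_le_half hσ p))).trans ?_
    gcongr
    have h2 : (1 : ℝ) ≤ p := by exact_mod_cast p.2.one_lt.le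
    have h3 : |F p| ≤ (p : ℝ)⁻¹ := (hF p).trans (by
      rw [← Real.rpow_neg_one]
      exact Real.rpow_le_rpow_of_exponent_le h2 (by linarith))
    rw [← inv_pow, ← sq_abs]
    gcongr

end EulerProduct

lemma rpow_neg_succ_le {δ : ℝ} (hδ : 0 < δ) (n : ℕ) :
    δ * ((n + 2 : ℕ) : ℝ) ^ (-(1 + δ)) ≤
      ((n + 1 : ℕ) : ℝ) ^ (-δ) - ((n + 2 : ℕ) : ℝ) ^ (-δ) := by
  have ha : (0 : ℝ) < ((n + 1 : ℕ) : ℝ) := by positivity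
  have hb : (0 : ℝ) < ((n + 2 : ℕ) : ℝ) := by positivity
  have hab : ((n + 1 : ℕ) : ℝ) = ((n + 2 : ℕ) : ℝ) - 1 := by push_cast; ring
  set a := ((n + 1 : ℕ) : ℝ)
  set b := ((n + 2 : ℕ) : ℝ)
  have h1 : Real.log (a / b) ≤ -b⁻¹ := by
    have := Real.log_le_sub_one_of_pos (div_pos ha hb)
    have h2 : a / b - 1 = -b⁻¹ := by
      rw [hab]
      field_simp
      ring
    linarith
  have h3 : 1 + δ * b⁻¹ ≤ (a / b) ^ (-δ) := by
    rw [Real.rpow_def_of_pos (div_pos ha hb)]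
    have := Real.add_one_le_exp (Real.log (a / b) * -δ)
    nlinarith
  rw [Real.div_rpow ha.le hb.le, le_div_iff₀ (Real.rpow_pos_of_pos hb _)] at h3
  rw [show -(1 + δ) = -δ + -1 by ring, Real.rpow_add hb, Real.rpow_neg_one]
  linarith

lemma tsum_rpow_neg_le {δ : ℝ} (hδ : 0 < δ) : ∑' n : ℕ, (n : ℝ) ^ (-(1 + δ)) ≤ 1 + δ⁻¹ := by
  have hs := summable_rpow_neg (σ := 1 + δ) (by linarith)
  refine hs.tsum_le_of_sum_range_le fun N => ?_
  have h : ∀ M : ℕ, ∑ n ∈ Finset.range (M + 2), (n : ℝ) ^ (-(1 + δ)) ≤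
      1 + δ⁻¹ * (1 - ((M + 1 : ℕ) : ℝ) ^ (-δ)) := by
    intro M
    induction M with
    | zero =>
      simp [Finset.sum_range_succ, Real.zero_rpow (show -δ + -1 ≠ 0 by linarith)]
    | succ M ih =>
      rw [Finset.sum_range_succ]
      have h1 := rpow_neg_succ_le hδ M
      have h2 : ((M + 2 : ℕ) : ℝ) ^ (-(1 + δ)) ≤
          δ⁻¹ * (((M + 1 : ℕ) : ℝ) ^ (-δ) - ((M + 2 : ℕ) : ℝ) ^ (-δ)) := by
        rw [inv_mul_eq_div, le_div_iff₀ hδ]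
        linarith
      have h3 : ((M + 1 + 1 : ℕ) : ℝ) = ((M + 2 : ℕ) : ℝ) := rfl
      rw [h3]
      linarith
  calc _ ≤ ∑ n ∈ Finset.range (N + 2), (n : ℝ) ^ (-(1 + δ)) :=
        Finset.sum_le_sum_of_subset_of_nonneg (Finset.range_mono (by omega))
          fun n _ _ => Real.rpow_nonneg (Nat.cast_nonneg n) _
    _ ≤ _ := h N
    _ ≤ _ := by
      have : 0 ≤ δ⁻¹ * ((N + 1 : ℕ) : ℝ) ^ (-δ) := by positivity
      linarith

lemma tsum_primes_rpow_neg_le {δ : ℝ} (hδ : 0 < δ) :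
    ∑' p : Nat.Primes, (p : ℝ) ^ (-(1 + δ)) ≤ Real.log (1 + δ⁻¹) := by
  have hσ : 1 < 1 + δ := by linarith
  rw [Real.le_log_iff_exp_le (by positivity)]
  refine (exp_tsum_primes_le (F := rpowNegHom hσ) hσ fun n => ?_).trans (tsum_rpow_neg_le hδ)
  exact (abs_of_nonneg (Real.rpow_nonneg (Nat.cast_nonneg n) _)).le

/-- The prime sums `∑ χ(p) p ^ (-σ)` of a function `χ`. -/
noncomputable def primeSum (f : ℕ →*₀ ℝ) (σ : ℝ) : ℝ := ∑' p : Nat.Primes, f p * (p : ℝ) ^ (-σ)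

namespace IsRealChar

variable {f : ℕ →*₀ ℝ} {q : ℕ}

/-- A completely multiplicative function as an arithmetic function. -/
def toArithmeticFunction (f : ℕ →*₀ ℝ) : ArithmeticFunction ℝ := ⟨f, map_zero f⟩

/-- The Dirichlet convolution `1 * f`. -/
noncomputable def divisorSum (f : ℕ →*₀ ℝ) : ArithmeticFunction ℝ :=
  (ArithmeticFunction.zeta : ArithmeticFunction ℝ) * toArithmeticFunction f

lemma divisorSum_apply (f : ℕ →*₀ ℝ) (n : ℕ) : divisorSum f n = ∑ d ∈ n.divisors, f d := by
  rw [divisorSum, ArithmeticFunction.coe_zeta_mul_apply]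
  rfl

lemma isMultiplicative_divisorSum (f : ℕ →*₀ ℝ) : (divisorSum f).IsMultiplicative :=
  ArithmeticFunction.isMultiplicative_zeta.natCast.mul
    ⟨map_one f, fun {m n} _ => map_mul f m n⟩

lemma divisorSum_prime_pow {p : ℕ} (hp : p.Prime) (k : ℕ) :
    divisorSum f (p ^ k) = ∑ i ∈ Finset.range (k + 1), f p ^ i := by
  rw [divisorSum_apply, Nat.sum_divisors_prime_pow hp]
  simp

lemma divisorSum_prime_pow_nonneg (hf : IsRealChar f q) {p : ℕ} (hp : p.Prime) (k : ℕ) :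
    0 ≤ divisorSum f (p ^ k) := by
  rw [divisorSum_prime_pow hp]
  rcases hf.values p with h | h | h <;> rw [h]
  · exact Finset.sum_nonneg fun i _ => by positivity
  · exact Finset.sum_nonneg fun i _ => by positivity
  · rw [neg_one_geom_sum]
    split_ifs <;> norm_num

lemma one_le_divisorSum_prime_pow (hf : IsRealChar f q) {p : ℕ} (hp : p.Prime) (k : ℕ) :
    1 ≤ divisorSum f (p ^ (2 * k)) := by
  rw [divisorSum_prime_pow hp]
  rcases hf.values p with h | h | h <;> rw [h]
  · simp [Finset.sum_range_succ']
  · simp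
  · rw [neg_one_geom_sum, if_neg (by simp)]

lemma divisorSum_nonneg (hf : IsRealChar f q) (n : ℕ) : 0 ≤ divisorSum f n := by
  rcases eq_or_ne n 0 with rfl | hn
  · simp
  · rw [(isMultiplicative_divisorSum f).multiplicative_factorization _ hn]
    exact Finset.prod_nonneg fun p hp =>
      hf.divisorSum_prime_pow_nonneg (Nat.prime_of_mem_primeFactors hp) _

lemma one_le_divisorSum_sq (hf : IsRealChar f q) {k : ℕ} (hk : k ≠ 0) :
    1 ≤ divisorSum f (k ^ 2) := by
  rw [(isMultiplicative_divisorSum f).multiplicative_factorization _ (pow_ne_zero 2 hk)]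
  refine Finset.one_le_prod fun p hp => ?_
  have hp' : p.Prime := Nat.prime_of_mem_primeFactors hp
  simpa using hf.one_le_divisorSum_prime_pow hp' (k.factorization p)

lemma summable_mul_geom {t : ℝ} (hf : IsRealChar f q) (ht : 0 < t) (ht1 : t < 1) :
    Summable fun n : ℕ => f (n + 1) * (t ^ (n + 1) / (1 - t ^ (n + 1))) := by
  refine Summable.of_norm_bounded (g := fun n : ℕ => (1 - t)⁻¹ * t ^ n)
    ((summable_geometric_of_lt_one ht.le ht1).mul_left _) fun n => ?_
  have h1 : t ^ (n + 1) ≤ t := by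
    simpa using pow_le_pow_of_le_one ht.le ht1.le (Nat.le_add_left 1 n)
  have h2 : 0 < 1 - t := by linarith
  have h3 : t ^ (n + 1) ≤ t ^ n := pow_le_pow_of_le_one ht.le ht1.le (by omega)
  have h4 : 0 ≤ t ^ (n + 1) / (1 - t ^ (n + 1)) := div_nonneg (by positivity) (by linarith)
  rw [norm_mul, Real.norm_eq_abs, Real.norm_eq_abs, abs_of_nonneg h4]
  calc _ ≤ 1 * (t ^ (n + 1) / (1 - t ^ (n + 1))) := by gcongr; exact hf.abs_le_one _
    _ ≤ 1 * (t ^ n / (1 - t)) := by gcongr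
    _ = _ := by rw [one_mul, div_eq_inv_mul]

lemma lambert_eq {t : ℝ} (hf : IsRealChar f q) (ht : 0 < t) (ht1 : t < 1) :
    HasSum (fun n : ℕ+ => divisorSum f n * t ^ (n : ℕ))
      (∑' n : ℕ, f (n + 1) * (t ^ (n + 1) / (1 - t ^ (n + 1)))) := by
  have hnorm : ‖t‖ < 1 := by rwa [Real.norm_of_nonneg ht.le]
  have hs : Summable fun c : ℕ+ × ℕ+ => f c.1 * t ^ ((c.1 : ℕ) * c.2) := by
    refine Summable.of_norm_bounded (summable_prod_mul_pow 0 hnorm) fun c => ?_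
    rw [norm_mul, pow_zero, Real.norm_of_nonneg (by positivity : 0 ≤ t ^ ((c.1 : ℕ) * c.2))]
    gcongr
    exact hf.abs_le_one _
  have h1 : ∑' n : ℕ, f (n + 1) * (t ^ (n + 1) / (1 - t ^ (n + 1))) =
      ∑' c : ℕ+ × ℕ+, f c.1 * t ^ ((c.1 : ℕ) * c.2) := by
    rw [hs.tsum_prod, ← tsum_pnat_eq_tsum_succ (f := fun n => f n * (t ^ n / (1 - t ^ n)))]
    refine tsum_congr fun n => ?_
    change _ = ∑' c : ℕ+, f n * t ^ ((n : ℕ) * c)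
    rw [tsum_mul_left, tsum_pnat_eq_tsum_succ (f := fun m => t ^ ((n : ℕ) * m))]
    have hn : t ^ (n : ℕ) < 1 := pow_lt_one₀ ht.le ht1 n.ne_zero
    have := tsum_geometric_of_lt_one (pow_nonneg ht.le (n : ℕ)) hn
    simp only [pow_mul, pow_succ _ _, tsum_mul_right, this]
    ring
  rw [h1]
  have h2 := (sigmaAntidiagonalEquivProd.hasSum_iff.mpr hs.hasSum).sigma fun n => hasSum_fintype _
  convert h2 using 2 with n
  rw [divisorSum_apply, Finset.sum_mul]
  simp only [sigmaAntidiagonalEquivProd, divisorsAntidiagonalFactors, PNat.mk_coe,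
    Equiv.coe_fn_mk, Function.comp_apply, Finset.univ_eq_attach]
  rw [(n : ℕ).divisorsAntidiagonal.sum_attach fun x : ℕ × ℕ => f x.1 * t ^ (x.1 * x.2),
    Nat.sum_divisorsAntidiagonal fun x y => f x * t ^ (x * y)]
  exact Finset.sum_congr rfl fun i hi => by
    rw [Nat.mul_div_cancel' (Nat.dvd_of_mem_divisors hi)]

lemma mul_pow_le_lambert {t : ℝ} (hf : IsRealChar f q) (ht : 0 < t) (ht1 : t < 1) (K : ℕ) :
    K * t ^ (K ^ 2) ≤ ∑' n : ℕ, f (n + 1) * (t ^ (n + 1) / (1 - t ^ (n + 1))) := by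
  have hinj : Function.Injective fun k : Fin K => Nat.toPNat' ((k + 1) ^ 2) := by
    intro a b hab
    have h : ((a : ℕ) + 1) ^ 2 = ((b : ℕ) + 1) ^ 2 := by
      simpa [Nat.toPNat'_coe] using congrArg PNat.val hab
    have := Nat.pow_left_injective (n := 2) (by norm_num) h
    exact Fin.ext (by simpa using this)
  calc (K : ℝ) * t ^ (K ^ 2) = ∑ k : Fin K, t ^ (K ^ 2) := by simp
    _ ≤ ∑ k : Fin K, divisorSum f ((k + 1) ^ 2) * t ^ (((k : ℕ) + 1) ^ 2) := by
        refine Finset.sum_le_sum fun k _ => ?_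
        rw [← one_mul (t ^ (K ^ 2))]
        have h2 : t ^ (K ^ 2) ≤ t ^ (((k : ℕ) + 1) ^ 2) :=
          pow_le_pow_of_le_one ht.le ht1.le (Nat.pow_le_pow_left k.2 2)
        exact mul_le_mul (hf.one_le_divisorSum_sq (Nat.succ_ne_zero k)) h2 (by positivity)
          (hf.divisorSum_nonneg _)
    _ = ∑ n ∈ Finset.univ.map ⟨_, hinj⟩, divisorSum f (n : ℕ) * t ^ (n : ℕ) := by
        rw [Finset.sum_map]
        simp [Nat.toPNat'_coe]
    _ ≤ _ := by
        have h := hf.lambert_eq ht ht1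
        exact sum_le_hasSum _ (fun n _ => mul_nonneg (hf.divisorSum_nonneg _) (by positivity)) h

lemma summable_mul_rpow {σ : ℝ} (hf : IsRealChar f q) (hσ : 1 < σ) :
    Summable fun n : ℕ => f n * (n : ℝ) ^ (-σ) := by
  refine Summable.of_norm_bounded (summable_rpow_neg hσ) fun n => ?_
  rw [norm_mul, Real.norm_eq_abs, Real.norm_of_nonneg (Real.rpow_nonneg (Nat.cast_nonneg n) _)]
  exact mul_le_of_le_one_left (Real.rpow_nonneg (Nat.cast_nonneg n) _) (hf.abs_le_one n)

lemma tsum_eq_tsum_succ {σ : ℝ} (hf : IsRealChar f q) (hσ : 1 < σ) :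
    ∑' n : ℕ, f n * (n : ℝ) ^ (-σ) = ∑' n : ℕ, f (n + 1) * ((n + 1 : ℕ) : ℝ) ^ (-σ) := by
  rw [(hf.summable_mul_rpow hσ).tsum_eq_zero_add]
  simp

lemma lambert_sub_le {σ t : ℝ} (hf : IsRealChar f q) (hσ : 1 < σ) (ht : 0 < t) (ht1 : t < 1) :
    σ * (1 - t) * (∑' n : ℕ, f (n + 1) * (t ^ (n + 1) / (1 - t ^ (n + 1)))) -
      q * (σ * (1 - t) + (σ - 1)) ≤ ∑' n : ℕ, f n * (n : ℝ) ^ (-σ) := by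
  rw [hf.tsum_eq_tsum_succ hσ]
  have hs1 := ((summable_nat_add_iff 1).mpr (hf.summable_mul_rpow hσ)).hasSum.tendsto_sum_nat
  have hs2 := (hf.summable_mul_geom ht ht1).hasSum.tendsto_sum_nat
  refine le_of_tendsto_of_tendsto' ((hs2.const_mul (σ * (1 - t))).sub_const _) hs1 fun N => ?_
  have h1 := abs_sum_mul_le_of_antitone (antitone_inv_sub_geom ht ht1) (inv_sub_geom_nonneg ht ht1)
    hf.abs_sum_range_succ_le N
  have h2 := abs_sum_mul_le_of_antitone (antitone_mul_inv_sub_rpow hσ.le)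
    (mul_inv_sub_rpow_nonneg hσ.le) hf.abs_sum_range_succ_le N
  have e1 : (((0 + 1 : ℕ) : ℝ)⁻¹ - (1 - t) * (t ^ (0 + 1) / (1 - t ^ (0 + 1)))) = 1 - t := by
    have : 1 - t ≠ 0 := by linarith
    simp only [zero_add, pow_one, Nat.cast_one, inv_one]
    field_simp
  have e2 : σ * ((0 + 1 : ℕ) : ℝ)⁻¹ - ((0 + 1 : ℕ) : ℝ) ^ (-σ) = σ - 1 := by simp
  rw [e1] at h1
  rw [e2] at h2
  have h3 : ∑ n ∈ Finset.range N, f (n + 1) * ((n + 1 : ℕ) : ℝ) ^ (-σ) =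
      σ * (1 - t) * ∑ n ∈ Finset.range N, f (n + 1) * (t ^ (n + 1) / (1 - t ^ (n + 1))) +
      σ * ∑ n ∈ Finset.range N, f (n + 1) *
        (((n + 1 : ℕ) : ℝ)⁻¹ - (1 - t) * (t ^ (n + 1) / (1 - t ^ (n + 1)))) -
      ∑ n ∈ Finset.range N, f (n + 1) *
        (σ * ((n + 1 : ℕ) : ℝ)⁻¹ - ((n + 1 : ℕ) : ℝ) ^ (-σ)) := by
    simp only [Finset.mul_sum, ← Finset.sum_add_distrib, ← Finset.sum_sub_distrib]
    exact Finset.sum_congr rfl fun n _ => by ring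
  rw [h3]
  have h4 := (abs_le.mp h1).1
  have h5 := (abs_le.mp h2).2
  have h6 := mul_le_mul_of_nonneg_left h4 (show 0 ≤ σ by linarith)
  linarith

/-- An elementary lower bound for the `L`-function of a real character close to `1`. -/
lemma le_tsum {σ : ℝ} (hf : IsRealChar f q) (hσ : 1 < σ) (hqσ : 128 * (q : ℝ) ^ 2 * (σ - 1) ≤ 1) :
    1 / (128 * q) ≤ ∑' n : ℕ, f n * (n : ℝ) ^ (-σ) := by
  have hq : (1 : ℝ) ≤ q := by exact_mod_cast hf.pos
  set y : ℝ := 1 / (64 * (q : ℝ) ^ 2) with hy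
  have hy0 : 0 < y := by positivity
  have hy1 : y ≤ 1 / 64 := by
    rw [hy]
    gcongr
    nlinarith
  have h1 := hf.lambert_sub_le hσ (t := 1 - y) (by linarith) (by linarith)
  have h2 := hf.mul_pow_le_lambert (t := 1 - y) (by linarith) (by linarith) (8 * q)
  have h3 : (1 / 4 : ℝ) ≤ (1 - y) ^ ((8 * q) ^ 2) := by
    have h4 : (1 / 2 : ℝ) ≤ (1 - y) ^ (32 * q ^ 2) := by
      have := one_add_mul_le_pow (a := -y) (by linarith) (32 * q ^ 2)
      have h5 : 1 + ((32 * q ^ 2 : ℕ) : ℝ) * -y = 1 / 2 := by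
        rw [hy]
        push_cast
        field_simp
        norm_num
      rwa [h5, ← sub_eq_add_neg] at this
    calc (1 / 4 : ℝ) = (1 / 2) ^ 2 := by norm_num
      _ ≤ ((1 - y) ^ (32 * q ^ 2)) ^ 2 := by gcongr
      _ = _ := by rw [← pow_mul]; congr 1; ring
  have h4 : (2 * q : ℝ) ≤ ∑' n : ℕ, f (n + 1) * ((1 - y) ^ (n + 1) / (1 - (1 - y) ^ (n + 1))) := by
    refine le_trans ?_ h2
    push_cast
    nlinarith
  rw [sub_sub_cancel] at h1
  have h5 : σ * y * (2 * q) ≤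
      σ * y * ∑' n : ℕ, f (n + 1) * ((1 - y) ^ (n + 1) / (1 - (1 - y) ^ (n + 1))) := by
    gcongr
  have h6 : y * q = 2 * (1 / (128 * q)) := by
    rw [hy]
    field_simp
    norm_num
  have h7 : q * (σ - 1) ≤ 1 / (128 * q) := by
    rw [le_div_iff₀ (by positivity)]
    linarith
  have h8 : 1 * (y * q) ≤ σ * (y * q) := by gcongr
  linarith

lemma tsum_le {σ : ℝ} (hf : IsRealChar f q) (hσ : 1 < σ) :
    ∑' n : ℕ, f n * (n : ℝ) ^ (-σ) ≤ 2 + Real.log q := by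
  rw [hf.tsum_eq_tsum_succ hσ]
  have hs := (summable_nat_add_iff 1).mpr (hf.summable_mul_rpow hσ)
  rw [← hs.sum_add_tsum_nat_add q]
  have h1 : ∑ n ∈ Finset.range q, f (n + 1) * ((n + 1 : ℕ) : ℝ) ^ (-σ) ≤ 1 + Real.log q := by
    refine le_trans ?_ (harmonic_le_one_add_log q)
    rw [harmonic]
    push_cast
    refine Finset.sum_le_sum fun n _ => ?_
    have h0 : (1 : ℝ) ≤ (n : ℝ) + 1 := by linarith [n.cast_nonneg (α := ℝ)]
    calc _ ≤ 1 * ((n : ℝ) + 1) ^ (-σ) := by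
          gcongr
          exact (le_abs_self _).trans (hf.abs_le_one _)
      _ ≤ _ := by
        rw [one_mul, ← Real.rpow_neg_one]
        exact Real.rpow_le_rpow_of_exponent_le h0 (by linarith)
  have h2 : ∑' n : ℕ, f (n + q + 1) * ((n + q + 1 : ℕ) : ℝ) ^ (-σ) ≤ 1 := by
    have hs2 := ((summable_nat_add_iff q).mpr hs).hasSum.tendsto_sum_nat
    refine le_of_tendsto' hs2 fun N => ?_
    have hanti : Antitone fun n : ℕ => ((n + q + 1 : ℕ) : ℝ) ^ (-σ) := fun a b hab => by
      refine Real.rpow_le_rpow_of_nonpos (by positivity) ?_ (by linarith)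
      gcongr
    have h3 := abs_sum_mul_le_of_antitone hanti (fun n => by positivity)
      hf.abs_sum_range_succ_le N
    have h4 : ∀ n, f (n + q + 1) = f (n + 1) := fun n => by
      rw [add_right_comm]
      exact hf.periodic (n + 1)
    simp only [h4]
    refine (le_abs_self _).trans (h3.trans ?_)
    have hq : (0 : ℝ) < ((0 + q + 1 : ℕ) : ℝ) := by positivity
    calc _ ≤ (q : ℝ) * ((0 + q + 1 : ℕ) : ℝ) ^ (-1 : ℝ) := by
          gcongr
          · exact_mod_cast (by omega : 1 ≤ 0 + q + 1)
      _ ≤ 1 := by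
        rw [Real.rpow_neg_one, mul_inv_le_iff₀ hq]
        push_cast
        linarith
  linarith

lemma abs_mul_rpow_le {σ : ℝ} (hf : IsRealChar f q) (hσ : 1 < σ) (n : ℕ) :
    |(f * rpowNegHom hσ) n| ≤ (n : ℝ) ^ (-σ) := by
  have h0 : 0 ≤ (n : ℝ) ^ (-σ) := Real.rpow_nonneg (Nat.cast_nonneg n) _
  change |f n * (n : ℝ) ^ (-σ)| ≤ _
  rw [abs_mul, abs_of_nonneg h0]
  exact mul_le_of_le_one_left h0 (hf.abs_le_one n)

lemma primeSum_le {σ : ℝ} (hf : IsRealChar f q) (hσ : 1 < σ) :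
    primeSum f σ ≤ Real.log (2 + Real.log q) := by
  have hq : 0 ≤ Real.log q := Real.log_natCast_nonneg q
  rw [Real.le_log_iff_exp_le (by linarith)]
  exact (exp_tsum_primes_le hσ (hf.abs_mul_rpow_le hσ)).trans (hf.tsum_le hσ)

lemma le_primeSum {σ : ℝ} (hf : IsRealChar f q) (hσ : 1 < σ)
    (hqσ : 128 * (q : ℝ) ^ 2 * (σ - 1) ≤ 1) :
    -Real.log (128 * q) - ∑' p : Nat.Primes, ((p : ℝ) ^ 2)⁻¹ ≤ primeSum f σ := by
  have hq : (0 : ℝ) < q := by exact_mod_cast hf.pos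
  have h1 := (hf.le_tsum hσ hqσ).trans (tsum_le_exp_tsum_primes hσ (hf.abs_mul_rpow_le hσ))
  rw [← Real.log_le_iff_le_exp (by positivity), one_div, Real.log_inv] at h1
  change _ ≤ primeSum f σ + _ at h1
  linarith

end IsRealChar

section QuadraticCharacter

open NumberTheorySymbols

lemma exists_jacobiSym_eq_neg_one_of_prime_dvd {s : ℤ} (hs : Squarefree s) {l : ℕ} (hl : l.Prime)
    (hl2 : l ≠ 2) (hls : (l : ℤ) ∣ s) : ∃ n : ℕ, Odd n ∧ J(s | n) = -1 := by
  have : Fact l.Prime := ⟨hl⟩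
  obtain ⟨s', rfl⟩ := hls
  have hs'0 : s' ≠ 0 := fun h => hs.ne_zero (by simp [h])
  have hls' : ¬ l ∣ s'.natAbs := fun h => by
    have h1 : (l : ℤ) * l ∣ l * s' := mul_dvd_mul_left _ (Int.natCast_dvd.mpr h)
    have h2 := hs _ h1
    rw [Int.isUnit_iff] at h2
    have := hl.two_le
    omega
  have hodd : Odd l := hl.odd_of_ne_two hl2
  obtain ⟨r, hr⟩ := FiniteField.exists_nonsquare (F := ZMod l) (by rwa [ZMod.ringChar_zmod_n])
  have hcop : Nat.Coprime (4 * s'.natAbs) l := by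
    refine Nat.Coprime.mul_left ?_ ((hl.coprime_iff_not_dvd.mpr hls').symm)
    exact (Nat.coprime_pow_left_iff (n := 2) (by norm_num) 2 l).mpr
      (Nat.coprime_two_left.mpr hodd)
  obtain ⟨n, hn1, hn2⟩ := Nat.chineseRemainder hcop 1 r.val
  have hs'1 : 0 < s'.natAbs := Int.natAbs_pos.mpr hs'0
  have hn4 : n % 4 = 1 := (hn1.of_mul_right _ : n ≡ 1 [MOD 4])
  have hnodd : Odd n := Nat.odd_iff.mpr (by omega)
  refine ⟨n, hnodd, ?_⟩
  have h1 : J(s' | n) = 1 := by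
    rw [jacobiSym.mod_right s' hnodd, show n % (4 * s'.natAbs) = 1 % (4 * s'.natAbs) from hn1,
      Nat.mod_eq_of_lt (by omega), jacobiSym.one_right]
  rw [jacobiSym.mul_left, h1, mul_one, jacobiSym.quadratic_reciprocity_one_mod_four' hodd hn4,
    ZMod.nonsquare_iff_jacobiSym_eq_neg_one]
  have h2 : (n : ZMod l) = r := by
    rw [(ZMod.natCast_eq_natCast_iff _ _ _).mpr hn2, ZMod.natCast_zmod_val]
  simpa [h2] using hr

lemma exists_jacobiSym_eq_neg_one {s : ℤ} (hs : Squarefree s) (hs1 : s ≠ 1) :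
    ∃ n : ℕ, Odd n ∧ J(s | n) = -1 := by
  by_cases h : ∃ l : ℕ, l.Prime ∧ l ≠ 2 ∧ (l : ℤ) ∣ s
  · obtain ⟨l, hl, hl2, hls⟩ := h
    exact exists_jacobiSym_eq_neg_one_of_prime_dvd hs hl hl2 hls
  · push Not at h
    have h2 : s.natAbs ∣ 2 := by
      have hsq : Squarefree s.natAbs := Int.squarefree_natAbs.mpr hs
      rw [← Nat.prod_primeFactors_of_squarefree hsq, ← Finset.prod_singleton (fun n : ℕ => n) 2]
      refine Finset.prod_dvd_prod_of_subset _ _ _ fun p hp => ?_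
      rw [Finset.mem_singleton]
      by_contra h3
      exact h p (Nat.prime_of_mem_primeFactors hp) h3
        (Int.natCast_dvd.mpr (Nat.dvd_of_mem_primeFactors hp))
    have h3 : s = -1 ∨ s = 2 ∨ s = -2 := by
      rcases (Nat.dvd_prime Nat.prime_two).mp h2 with h4 | h4 <;> omega
    rcases h3 with rfl | rfl | rfl
    · exact ⟨3, by decide, by norm_num⟩
    · exact ⟨3, by decide, by norm_num⟩
    · exact ⟨5, by decide, by norm_num⟩

lemma jacobiSym_four_mul {n : ℕ} (hn : Odd n) (a : ℤ) : J(4 * a | n) = J(a | n) := by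
  have h : (2 : ℤ).gcd n = 1 := Nat.coprime_two_left.mpr hn
  rw [jacobiSym.mul_left, show (4 : ℤ) = 2 ^ 2 by norm_num, jacobiSym.sq_one' h, one_mul]

lemma jacobiSym_four_mul_of_even {n : ℕ} (hn : Even n) (hn0 : n ≠ 0) (a : ℤ) :
    J(4 * a | n) = 0 := by
  have : NeZero n := ⟨hn0⟩
  rw [jacobiSym.eq_zero_iff_not_coprime]
  intro h
  have h1 : (2 : ℤ) ∣ ((4 * a).gcd n : ℤ) :=
    Int.dvd_coe_gcd ⟨2 * a, by ring⟩ (by exact_mod_cast hn.two_dvd)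
  rw [h] at h1
  norm_num at h1

lemma exists_prime_jacobiSym_eq_neg_one {a : ℤ} (ha : a ≠ 0) (ha' : ¬ IsSquare a) :
    ∃ p : ℕ, p.Prime ∧ J(4 * a | p) = -1 := by
  obtain ⟨s, b, hs, hb, rfl⟩ := exists_int_eq_squarefree_mul_sq ha
  have hs1 : s ≠ 1 := fun h => ha' ⟨b, by rw [h]; ring⟩
  obtain ⟨n, hn, hJ⟩ := exists_jacobiSym_eq_neg_one hs hs1
  have hs0 : 0 < s.natAbs := Int.natAbs_pos.mpr hs.ne_zero
  have hn0 : NeZero n := ⟨by rintro rfl; exact absurd hn (by decide)⟩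
  have : NeZero (4 * s.natAbs) := ⟨by positivity⟩
  have hcop : IsUnit (n : ZMod (4 * s.natAbs)) := by
    rw [ZMod.isUnit_iff_coprime]
    refine Nat.Coprime.mul_right ?_ ?_
    · exact ((Nat.coprime_pow_left_iff (n := 2) (by norm_num) 2 n).mpr
        (Nat.coprime_two_left.mpr hn)).symm
    · by_contra h
      have h1 : J(s | n) = 0 := by
        rw [jacobiSym.eq_zero_iff_not_coprime, Int.gcd_comm]
        exact h
      rw [h1] at hJ
      norm_num at hJ
  obtain ⟨p, hpb, hp, hpn⟩ := Nat.forall_exists_prime_gt_and_eq_mod hcop (max b 2)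
  have hp2 : Odd p := hp.odd_of_ne_two (by have := le_max_right b 2; omega)
  refine ⟨p, hp, ?_⟩
  have hpb' : (b : ℤ).gcd p = 1 := by
    rw [Int.gcd_natCast_natCast]
    exact Nat.coprime_comm.mp (hp.coprime_iff_not_dvd.mpr
      (Nat.not_dvd_of_pos_of_lt hb.bot_lt (lt_of_le_of_lt (le_max_left b 2) hpb)))
  rw [jacobiSym_four_mul hp2, jacobiSym.mul_left, jacobiSym.sq_one' hpb', mul_one,
    jacobiSym.mod_right s hp2, (ZMod.natCast_eq_natCast_iff _ _ _).mp hpn,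
    ← jacobiSym.mod_right s hn, hJ]

/-- The Kronecker-type character `n ↦ (4a / n)`, extended by zero. -/
noncomputable def quadChar (a : ℤ) : ℕ →*₀ ℝ where
  toFun n := if n = 0 then 0 else (J(4 * a | n) : ℝ)
  map_zero' := by simp
  map_one' := by simp
  map_mul' m n := by
    rcases eq_or_ne m 0 with rfl | hm
    · simp
    rcases eq_or_ne n 0 with rfl | hn
    · simp
    have : NeZero m := ⟨hm⟩
    have : NeZero n := ⟨hn⟩
    simp [hm, hn, jacobiSym.mul_right]

lemma quadChar_apply (a : ℤ) {n : ℕ} (hn : n ≠ 0) : quadChar a n = J(4 * a | n) := if_neg hn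

lemma quadChar_values (a : ℤ) (n : ℕ) :
    quadChar a n = 0 ∨ quadChar a n = 1 ∨ quadChar a n = -1 := by
  rcases eq_or_ne n 0 with rfl | hn
  · simp
  · rw [quadChar_apply a hn]
    rcases jacobiSym.trichotomy (4 * a) n with h | h | h <;> simp [h]

lemma isRealChar_quadChar {a : ℤ} (ha : a ≠ 0) (ha' : ¬ IsSquare a) :
    IsRealChar (quadChar a) (16 * a.natAbs) where
  pos := by positivity
  values := quadChar_values a
  periodic n := by
    have hq : 16 * a.natAbs ≠ 0 := by positivity
    rcases Nat.even_or_odd n with hn | hn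
    · have h0 : ∀ m : ℕ, Even m → quadChar a m = 0 := fun m hm => by
        rcases eq_or_ne m 0 with rfl | hm0
        · simp
        · rw [quadChar_apply a hm0, jacobiSym_four_mul_of_even hm hm0, Int.cast_zero]
      rw [h0 n hn, h0 _ (hn.add ⟨8 * a.natAbs, by ring⟩)]
    · have hn' : Odd (n + 16 * a.natAbs) := hn.add_even ⟨8 * a.natAbs, by ring⟩
      rw [quadChar_apply a (by omega),
        quadChar_apply a (by rintro rfl; exact absurd hn (by decide)),
        jacobiSym.mod_right _ hn', jacobiSym.mod_right _ hn, Int.natAbs_mul,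
        show 4 * ((4 : ℤ).natAbs * a.natAbs) = 16 * a.natAbs by simp; ring, Nat.add_mod_right]
  exists_eq_neg_one := by
    obtain ⟨p, hp, hJ⟩ := exists_prime_jacobiSym_eq_neg_one ha ha'
    refine ⟨p, ?_, by simp [quadChar_apply a hp.ne_zero, hJ]⟩
    rw [hp.coprime_iff_not_dvd]
    intro h
    have : NeZero p := ⟨hp.ne_zero⟩
    have h1 : J(4 * a | p) ≠ 0 := by rw [hJ]; norm_num
    rw [Ne, jacobiSym.eq_zero_iff_not_coprime, not_not] at h1
    have h2 : p ∣ (4 * a).natAbs := by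
      rw [show 16 * a.natAbs = 4 * (4 * a).natAbs by rw [Int.natAbs_mul]; simp; ring] at h
      rcases hp.dvd_mul.mp h with h | h
      · rw [Int.natAbs_mul]
        exact dvd_mul_of_dvd_left h _
      · exact h
    exact hp.one_lt.ne' (Nat.dvd_one.mp (h1 ▸ Nat.dvd_gcd h2 dvd_rfl))

lemma quadChar_mul_prime (a b : ℤ) {p : ℕ} (hp : p.Prime) :
    quadChar a p * quadChar b p = quadChar (a * b) p := by
  rw [quadChar_apply _ hp.ne_zero, quadChar_apply _ hp.ne_zero, quadChar_apply _ hp.ne_zero]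
  rcases hp.eq_two_or_odd' with rfl | hodd
  · simp [jacobiSym_four_mul_of_even even_two]
  · rw [jacobiSym_four_mul hodd, jacobiSym_four_mul hodd, jacobiSym_four_mul hodd,
      jacobiSym.mul_left]
    push_cast
    rfl

lemma dvd_of_quadChar_eq_zero {a : ℤ} {p : ℕ} (hp : p.Prime) (h : quadChar a p = 0) :
    p ∣ (4 * a).natAbs := by
  have : NeZero p := ⟨hp.ne_zero⟩
  rw [quadChar_apply _ hp.ne_zero, Int.cast_eq_zero, jacobiSym.eq_zero_iff_not_coprime,
    Int.gcd_comm] at h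
  by_contra h2
  exact h ((hp.coprime_iff_not_dvd).mpr h2)

end QuadraticCharacter

section PrimeSums

variable {σ : ℝ}

lemma abs_quadChar_le_one (a : ℤ) (n : ℕ) : |quadChar a n| ≤ 1 := by
  rcases quadChar_values a n with h | h | h <;> simp [h]

lemma hasSum_primeSum (hσ : 1 < σ) (a : ℤ) :
    HasSum (fun p : Nat.Primes => quadChar a p * (p : ℝ) ^ (-σ)) (primeSum (quadChar a) σ) :=
  (summable_primes_of_le hσ (abs_quadChar_le_one a)).hasSum

lemma hasSum_primes_rpow_neg (hσ : 1 < σ) :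
    HasSum (fun p : Nat.Primes => (p : ℝ) ^ (-σ)) (∑' p : Nat.Primes, (p : ℝ) ^ (-σ)) :=
  (Nat.Primes.summable_rpow.mpr (by linarith)).hasSum

lemma primeSum_quadChar_le (hσ : 1 < σ) (a : ℤ) :
    primeSum (quadChar a) σ ≤ ∑' p : Nat.Primes, (p : ℝ) ^ (-σ) :=
  hasSum_le (fun p : Nat.Primes => mul_le_of_le_one_left (Real.rpow_nonneg (Nat.cast_nonneg _) _)
    ((le_abs_self _).trans (abs_quadChar_le_one a p)))
    (hasSum_primeSum hσ a) (hasSum_primes_rpow_neg hσ)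

/-- The sum of `p ^ (-σ)` over the primes at which the character vanishes. -/
noncomputable def ramifiedSum (a : ℤ) (σ : ℝ) : ℝ :=
  ∑' p : Nat.Primes, (if quadChar a p = 0 then 1 else 0) * (p : ℝ) ^ (-σ)

lemma tsum_nonsplit (hσ : 1 < σ) (a : ℤ) (z : ℝ) :
    ∑' p : Nat.Primes, (if quadChar a p = 1 then 0 else z) * (p : ℝ) ^ (-σ) =
      z / 2 * (∑' p : Nat.Primes, (p : ℝ) ^ (-σ) - primeSum (quadChar a) σ + ramifiedSum a σ) := by
  have h : HasSum (fun p : Nat.Primes => (if quadChar a p = 0 then 1 else 0) * (p : ℝ) ^ (-σ))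
      (ramifiedSum a σ) :=
    (summable_primes_of_le (C := 1) (f := fun p => if quadChar a p = 0 then 1 else 0) hσ
      fun p => by split_ifs <;> simp).hasSum
  rw [← ((((hasSum_primes_rpow_neg hσ).sub (hasSum_primeSum hσ a)).add h).mul_left (z / 2)).tsum_eq]
  refine tsum_congr fun p => ?_
  rcases quadChar_values a p with h | h | h <;> norm_num [h] <;> ring

lemma two_pow_card_primeFactors_le {k : ℕ} (hk : k ≠ 0) : 2 ^ k.primeFactors.card ≤ k :=
  (Finset.pow_card_le_prod _ _ _ fun _ hp => (Nat.prime_of_mem_primeFactors hp).two_le).trans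
    (Nat.le_of_dvd hk.bot_lt (Nat.prod_primeFactors_dvd k))

lemma sum_primeFactors_inv_le {k : ℕ} (hk : k ≠ 0) :
    ∑ p ∈ k.primeFactors, (p : ℝ)⁻¹ ≤ 100 + Real.log k / 69 := by
  have h1 : ∀ p ∈ k.primeFactors, (p : ℝ)⁻¹ ≤ (if p < 100 then 1 else 0) + 1 / 100 := by
    intro p hp
    have hp1 : (1 : ℝ) ≤ p := by exact_mod_cast (Nat.prime_of_mem_primeFactors hp).one_lt.le
    split_ifs with h
    · linarith [inv_le_one_of_one_le₀ hp1]
    · have : (100 : ℝ) ≤ p := by exact_mod_cast not_lt.mp h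
      rw [zero_add, one_div]
      gcongr
  have h2 : ({p ∈ k.primeFactors | p < 100}).card ≤ 100 := by
    calc _ ≤ (Finset.range 100).card := Finset.card_le_card fun p hp => by
          simpa using (Finset.mem_filter.mp hp).2
      _ = 100 := Finset.card_range 100
  have h3 : (k.primeFactors.card : ℝ) * Real.log 2 ≤ Real.log k := by
    rw [← Real.log_pow]
    exact Real.log_le_log (by positivity) (by exact_mod_cast two_pow_card_primeFactors_le hk)
  have h4 := Real.log_two_gt_d9
  have h5 : (k.primeFactors.card : ℝ) * 0.69 ≤ Real.log k := by
    refine le_trans ?_ h3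
    gcongr
    linarith
  calc _ ≤ ∑ p ∈ k.primeFactors, ((if p < 100 then 1 else 0) + 1 / 100 : ℝ) :=
        Finset.sum_le_sum h1
    _ = ({p ∈ k.primeFactors | p < 100}).card + k.primeFactors.card * (1 / 100) := by
        rw [Finset.sum_add_distrib, Finset.sum_boole, Finset.sum_const, nsmul_eq_mul]
    _ ≤ 100 + Real.log k / 69 := by
        have : (({p ∈ k.primeFactors | p < 100}).card : ℝ) ≤ 100 := by exact_mod_cast h2
        linarith

lemma ramifiedSum_le (hσ : 1 < σ) {a : ℤ} (ha : a ≠ 0) :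
    ramifiedSum a σ ≤ 100 + Real.log (4 * |(a : ℝ)|) / 69 := by
  have hk : (4 * a).natAbs ≠ 0 := by simpa using ha
  have hk' : (((4 * a).natAbs : ℕ) : ℝ) = 4 * |(a : ℝ)| := by
    rw [Nat.cast_natAbs]
    push_cast
    rw [abs_mul]
    norm_num
  rw [← hk']
  refine le_trans ?_ (sum_primeFactors_inv_le hk)
  refine Real.tsum_le_of_sum_le (fun p => by positivity) fun s => ?_
  have h1 : ∑ p ∈ s, (if quadChar a p = 0 then 1 else 0) * (p : ℝ) ^ (-σ) =
      ∑ p ∈ s.map ⟨fun p : Nat.Primes => (p : ℕ), Nat.Primes.coe_nat_injective⟩,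
        (if quadChar a p = 0 then 1 else 0) * (p : ℝ) ^ (-σ) := by
    rw [Finset.sum_map]
    rfl
  rw [h1]
  simp only [ite_mul, one_mul, zero_mul]
  rw [← Finset.sum_filter]
  refine (Finset.sum_le_sum_of_subset_of_nonneg (t := (4 * a).natAbs.primeFactors)
    (fun p hp => ?_) fun p _ _ => by positivity).trans (Finset.sum_le_sum fun p hp => ?_)
  · obtain ⟨hp, h0⟩ := Finset.mem_filter.mp hp
    obtain ⟨p', -, rfl⟩ := Finset.mem_map.mp hp
    exact Nat.mem_primeFactors.mpr ⟨p'.2, dvd_of_quadChar_eq_zero p'.2 h0, hk⟩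
  · have hp1 : (1 : ℝ) ≤ p := by exact_mod_cast (Nat.prime_of_mem_primeFactors hp).one_lt.le
    rw [← Real.rpow_neg_one]
    exact Real.rpow_le_rpow_of_exponent_le hp1 (by linarith)

/-- Near-orthogonality of quadratic characters limits how many of them can have a prime sum that
is very negative. -/
lemma nonneg_of_primeSum_le (hσ : 1 < σ) {B : Finset ℤ} {R s t : ℝ} (hR : 0 ≤ R) (ht : 0 ≤ t)
    (hB : ∀ a ∈ B, ∀ b ∈ B, a ≠ b → primeSum (quadChar (a * b)) σ ≤ R)
    (hs : ∀ a ∈ B, primeSum (quadChar a) σ ≤ -s) :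
    0 ≤ B.card * ∑' p : Nat.Primes, (p : ℝ) ^ (-σ) + B.card ^ 2 * R - 2 * t * (B.card * s) +
      t ^ 2 * ∑' p : Nat.Primes, (p : ℝ) ^ (-σ) := by
  set l := ∑' p : Nat.Primes, (p : ℝ) ^ (-σ) with hl
  have h1 : HasSum (fun p : Nat.Primes => (p : ℝ) ^ (-σ) * (∑ a ∈ B, quadChar a p + t) ^ 2)
      (∑ a ∈ B, ∑ b ∈ B, primeSum (quadChar (a * b)) σ +
        2 * t * ∑ a ∈ B, primeSum (quadChar a) σ + t ^ 2 * l) := by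
    have h2 := (((hasSum_sum fun a (_ : a ∈ B) => hasSum_sum fun b (_ : b ∈ B) =>
      hasSum_primeSum hσ (a * b)).add ((hasSum_sum fun a (_ : a ∈ B) =>
      hasSum_primeSum hσ a).mul_left (2 * t))).add ((hasSum_primes_rpow_neg hσ).mul_left (t ^ 2)))
    convert h2 using 2 with p
    simp only [← quadChar_mul_prime _ _ p.2, ← Finset.sum_mul, ← Finset.mul_sum]
    ring
  have h3 := h1.nonneg fun p => by positivity
  have h4 : ∑ a ∈ B, ∑ b ∈ B, primeSum (quadChar (a * b)) σ ≤ B.card * l + B.card ^ 2 * R := by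
    calc _ ≤ ∑ a ∈ B, ∑ b ∈ B, ((if a = b then l else 0) + R) := by
          refine Finset.sum_le_sum fun a ha => Finset.sum_le_sum fun b hb => ?_
          split_ifs with h
          · linarith [primeSum_quadChar_le hσ (a * b)]
          · linarith [hB a ha b hb h]
      _ = _ := by
          simp only [Finset.sum_add_distrib, Finset.sum_const, nsmul_eq_mul, Finset.sum_ite_eq]
          rw [Finset.sum_congr rfl fun a ha => if_pos ha, Finset.sum_const, nsmul_eq_mul]
          ring
  have h5 : ∑ a ∈ B, primeSum (quadChar a) σ ≤ B.card * -s := by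
    rw [← nsmul_eq_mul]
    exact Finset.sum_le_card_nsmul _ _ _ hs
  have h6 := mul_le_mul_of_nonneg_left h5 (show 0 ≤ 2 * t by linarith)
  linarith

end PrimeSums

lemma not_isSquare_mul_of_squarefree {a b : ℤ} (ha : Squarefree a) (hb : Squarefree b)
    (hab : a ≠ b) : ¬ IsSquare (a * b) := by
  rintro ⟨c, hc⟩
  have h1 : ∀ {a b : ℤ}, Squarefree a → a * b = c * c → a ∣ b := by
    intro a b ha h
    obtain ⟨d, rfl⟩ : a ∣ c := by
      refine (ha.dvd_pow_iff_dvd two_ne_zero).mp ?_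
      rw [sq, ← h]
      exact dvd_mul_right a b
    exact ⟨d * d, mul_left_cancel₀ ha.ne_zero (by rw [h]; ring)⟩
  have h2 := Int.natAbs_eq_of_dvd_dvd (h1 ha hc) (h1 hb (by rw [mul_comm, hc]))
  rcases Int.natAbs_eq_natAbs_iff.mp h2 with h | h
  · exact hab h
  · have : 0 < b * b := mul_self_pos.mpr hb.ne_zero
    rw [h] at hc
    linarith [mul_self_nonneg c]

section Counting

variable {x u : ℝ}

lemma card_mul_le_of_le_prod {g : ℕ → ℝ} (hg0 : ∀ p, 0 ≤ g p) (hg2 : ∀ p, g p ≤ 2) (hx : 1 < x)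
    {T : Finset ℕ} (hT : T ⊆ squarefreeUpTo x) {w : ℝ}
    (hw : ∀ n ∈ T, w ≤ ∏ p ∈ n.primeFactors, g p) :
    T.card * w ≤ 12 * (x / Real.log x) *
      Real.exp (∑' p : Nat.Primes, g p * (p : ℝ) ^ (-(1 + 1 / Real.log x))) := by
  refine le_trans ?_ (sum_squarefree_le hg0 hg2 hx)
  rw [← nsmul_eq_mul]
  exact (Finset.card_nsmul_le_sum T _ w hw).trans
    (Finset.sum_le_sum_of_subset_of_nonneg hT fun n _ _ => Finset.prod_nonneg fun p _ => hg0 p)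

lemma card_le_of_tsum_le {g : ℕ → ℝ} (hg0 : ∀ p, 0 ≤ g p) (hg2 : ∀ p, g p ≤ 2) (hx : 1 < x)
    (hu : Real.log x = Real.exp u) {T : Finset ℕ} (hT : T ⊆ squarefreeUpTo x) {v s : ℝ}
    (hw : ∀ n ∈ T, Real.exp v ≤ ∏ p ∈ n.primeFactors, g p)
    (hs : ∑' p : Nat.Primes, g p * (p : ℝ) ^ (-(1 + 1 / Real.log x)) ≤ s) :
    (T.card : ℝ) ≤ 12 * x * Real.exp (s - u - v) := by
  have h := card_mul_le_of_le_prod hg0 hg2 hx hT hw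
  rw [← le_div_iff₀ (Real.exp_pos v)] at h
  calc _ ≤ _ := h
    _ ≤ 12 * (x / Real.log x) * Real.exp s / Real.exp v := by
        have : 0 < Real.log x := Real.log_pos hx
        gcongr
    _ = _ := by
        rw [Real.exp_sub, Real.exp_sub, hu]
        ring

lemma tsum_primes_le (hu0 : 0 ≤ u) (hu : Real.log x = Real.exp u) :
    ∑' p : Nat.Primes, (p : ℝ) ^ (-(1 + 1 / Real.log x)) ≤ u + 1 := by
  refine (tsum_primes_rpow_neg_le (by rw [hu]; positivity)).trans ?_
  rw [hu, one_div, inv_inv, ← Real.log_exp (u + 1), Real.exp_add]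
  have h1 : 1 ≤ Real.exp u := Real.one_le_exp hu0
  have h2 : 2 ≤ Real.exp 1 := by linarith [Real.add_one_le_exp 1]
  exact Real.log_le_log (by positivity) (by nlinarith)

lemma one_lt_one_add_inv_log (hu : Real.log x = Real.exp u) : 1 < 1 + 1 / Real.log x := by
  rw [hu]
  linarith [one_div_pos.mpr (Real.exp_pos u)]

/-- Few squarefree integers have fewer than `0.8 log log x` prime factors. -/
lemma card_few_primeFactors_le (hx : 1 < x) (hu0 : 0 ≤ u) (hu : Real.log x = Real.exp u)
    {T : Finset ℕ} (hT : T ⊆ squarefreeUpTo x)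
    (hω : ∀ n ∈ T, (n.primeFactors.card : ℝ) ≤ 4 / 5 * u) :
    (T.card : ℝ) ≤ 12 * x * Real.exp (1 - u / 100) := by
  have hl : (5 / 4 : ℝ) ≤ Real.exp (19 / 80) := by
    linarith [Real.quadratic_le_exp_of_nonneg (show (0 : ℝ) ≤ 19 / 80 by norm_num)]
  have hl' : Real.exp (-(19 / 80)) ≤ 4 / 5 := by
    rw [Real.exp_neg]
    exact inv_le_of_inv_le₀ (by norm_num) (by linarith)
  refine (card_le_of_tsum_le (g := fun _ => 4 / 5) (v := -(19 / 80) * (4 / 5 * u))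
    (s := 4 / 5 * (u + 1)) (fun _ => by norm_num) (fun _ => by norm_num) hx hu hT ?_ ?_).trans ?_
  · intro n hn
    rw [Finset.prod_const]
    refine le_trans ?_ (pow_le_pow_left₀ (Real.exp_pos _).le hl' _)
    rw [← Real.exp_nat_mul]
    refine Real.exp_le_exp.mpr ?_
    linarith [hω n hn]
  · rw [tsum_mul_left]
    linarith [tsum_primes_le hu0 hu]
  · exact mul_le_mul_of_nonneg_left (Real.exp_le_exp.mpr (by linarith)) (by linarith)

lemma ramifiedSum_le_of_abs_le (hu : Real.log x = Real.exp u) {a : ℤ} (ha : a ≠ 0)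
    (hab : |(a : ℝ)| ≤ Real.exp (u / 2) / 256) :
    ramifiedSum a (1 + 1 / Real.log x) ≤ 100 + u / 138 := by
  refine (ramifiedSum_le (one_lt_one_add_inv_log hu) ha).trans ?_
  have h1 : 0 < |(a : ℝ)| := by positivity
  have h2 : Real.log (4 * |(a : ℝ)|) ≤ u / 2 := by
    rw [Real.log_le_iff_le_exp (by positivity)]
    linarith [Real.exp_pos (u / 2)]
  linarith

/-- If `primeSum (quadChar a)` is not very negative, few integers with many prime factors have no
prime factor at which the character is `1`. -/
lemma card_nonsplit_le_of_le_primeSum (hx : 1 < x) (hu0 : 0 ≤ u) (hu : Real.log x = Real.exp u)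
    {a : ℤ} (ha : a ≠ 0) (hab : |(a : ℝ)| ≤ Real.exp (u / 2) / 256)
    (hS : -(u / 50) ≤ primeSum (quadChar a) (1 + 1 / Real.log x))
    {T : Finset ℕ} (hT : T ⊆ squarefreeUpTo x)
    (hω : ∀ n ∈ T, 4 / 5 * u ≤ n.primeFactors.card)
    (hs : ∀ n ∈ T, ∀ p ∈ n.primeFactors, quadChar a p ≠ 1) :
    (T.card : ℝ) ≤ 12 * x * Real.exp (101 - 13 / 25 * u) := by
  have hl : Real.exp (69 / 100) ≤ 2 := by
    rw [← Real.le_log_iff_exp_le (by norm_num)]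
    linarith [Real.log_two_gt_d9]
  refine (card_le_of_tsum_le (g := fun p => if quadChar a p = 1 then 0 else 2)
    (v := 69 / 100 * (4 / 5 * u)) (s := (u + 1) + u / 50 + (100 + u / 138))
    (fun _ => by positivity) (fun _ => by split_ifs <;> norm_num) hx hu hT ?_ ?_).trans ?_
  · intro n hn
    rw [Finset.prod_congr rfl fun p hp => if_neg (hs n hn p hp), Finset.prod_const]
    refine le_trans ?_ (pow_le_pow_left₀ (Real.exp_pos _).le hl _)
    rw [← Real.exp_nat_mul]
    refine Real.exp_le_exp.mpr ?_
    linarith [hω n hn]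
  · rw [tsum_nonsplit (one_lt_one_add_inv_log hu)]
    linarith [tsum_primes_le hu0 hu, ramifiedSum_le_of_abs_le hu ha hab]
  · exact mul_le_mul_of_nonneg_left (Real.exp_le_exp.mpr (by linarith)) (by linarith)

lemma natCast_natAbs_eq_abs (a : ℤ) : ((a.natAbs : ℕ) : ℝ) = |(a : ℝ)| := by
  rw [Nat.cast_natAbs, Int.cast_abs]

lemma le_primeSum_quadChar (hu : Real.log x = Real.exp u) {a : ℤ} (ha : a ≠ 0)
    (ha' : ¬ IsSquare a) (hab : |(a : ℝ)| ≤ Real.exp (u / 2) / 256) :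
    -(3 + u / 2) - ∑' p : Nat.Primes, ((p : ℝ) ^ 2)⁻¹ ≤
      primeSum (quadChar a) (1 + 1 / Real.log x) := by
  have h0 : 0 < |(a : ℝ)| := by positivity
  have he : Real.exp (u / 2) ^ 2 = Real.exp u := by
    rw [← Real.exp_nat_mul]
    congr 1
    push_cast
    ring
  have hq : ((16 * a.natAbs : ℕ) : ℝ) = 16 * |(a : ℝ)| := by
    rw [← natCast_natAbs_eq_abs]
    push_cast
    rfl
  refine le_trans ?_ ((isRealChar_quadChar ha ha').le_primeSum (one_lt_one_add_inv_log hu) ?_)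
  · have h8 : Real.log (128 * (16 * |(a : ℝ)|)) ≤ 3 + u / 2 := by
      rw [Real.log_le_iff_le_exp (by positivity), Real.exp_add]
      have h3 : (8 : ℝ) ≤ Real.exp 3 := by
        have := Real.exp_one_gt_d9
        calc (8 : ℝ) = 2 ^ 3 := by norm_num
          _ ≤ Real.exp 1 ^ 3 := by gcongr; linarith
          _ = Real.exp 3 := by rw [← Real.exp_nat_mul]; norm_num
      nlinarith [Real.exp_pos (u / 2)]
    rw [hq]
    linarith
  · rw [hq, hu, add_sub_cancel_left, mul_one_div, div_le_one (Real.exp_pos u), ← he]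
    nlinarith [Real.exp_pos (u / 2)]

/-- For every character, few integers have no prime factor at which the character is `1`. -/
lemma card_nonsplit_le (hx : 1 < x) (hu0 : 0 ≤ u) (hu : Real.log x = Real.exp u)
    {a : ℤ} (ha : a ≠ 0) (ha' : ¬ IsSquare a) (hab : |(a : ℝ)| ≤ Real.exp (u / 2) / 256)
    {T : Finset ℕ} (hT : T ⊆ squarefreeUpTo x)
    (hs : ∀ n ∈ T, ∀ p ∈ n.primeFactors, quadChar a p ≠ 1) :
    (T.card : ℝ) ≤
      12 * x * Real.exp (60 + ∑' p : Nat.Primes, ((p : ℝ) ^ 2)⁻¹ - u / 10) := by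
  have hC : 0 ≤ ∑' p : Nat.Primes, ((p : ℝ) ^ 2)⁻¹ := tsum_nonneg fun p => by positivity
  refine (card_le_of_tsum_le (g := fun p => if quadChar a p = 1 then 0 else 1) (v := 0)
    (s := 1 / 2 * ((u + 1) + (3 + u / 2 + ∑' p : Nat.Primes, ((p : ℝ) ^ 2)⁻¹) + (100 + u / 138)))
    (fun _ => by positivity) (fun _ => by split_ifs <;> norm_num) hx hu hT ?_ ?_).trans ?_
  · intro n hn
    rw [Finset.prod_congr rfl fun p hp => if_neg (hs n hn p hp), Finset.prod_const]
    simp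
  · rw [tsum_nonsplit (one_lt_one_add_inv_log hu)]
    linarith [tsum_primes_le hu0 hu, ramifiedSum_le_of_abs_le hu ha hab,
      le_primeSum_quadChar hu ha ha' hab]
  · exact mul_le_mul_of_nonneg_left (Real.exp_le_exp.mpr (by linarith)) (by linarith)

/-- Boundedly many quadratic characters have a very negative prime sum. -/
lemma card_primeSum_le_neg (hu1 : 1 ≤ u) (hu : Real.log x = Real.exp u)
    (hR : Real.log (2 + u) + 1 / 2500 ≤ u / 5000) {B : Finset ℤ}
    (hB : ∀ a ∈ B, Squarefree a ∧ |(a : ℝ)| ≤ Real.exp (u / 2) / 256 ∧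
      primeSum (quadChar a) (1 + 1 / Real.log x) ≤ -(u / 50)) :
    (B.card : ℝ) ≤ 10000 := by
  have he : Real.exp (u / 2) * Real.exp (u / 2) = Real.exp u := by
    rw [← Real.exp_add, add_halves]
  have h1 : ∀ a ∈ B, ∀ b ∈ B, a ≠ b →
      primeSum (quadChar (a * b)) (1 + 1 / Real.log x) ≤ Real.log (2 + u) := by
    intro a ha b hb hab
    obtain ⟨ha1, ha2, -⟩ := hB a ha
    obtain ⟨hb1, hb2, -⟩ := hB b hb
    have h0 : a * b ≠ 0 := mul_ne_zero ha1.ne_zero hb1.ne_zero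
    refine ((isRealChar_quadChar h0 (not_isSquare_mul_of_squarefree ha1 hb1 hab)).primeSum_le
      (one_lt_one_add_inv_log hu)).trans ?_
    have hq : ((16 * (a * b).natAbs : ℕ) : ℝ) = 16 * (|(a : ℝ)| * |(b : ℝ)|) := by
      rw [← abs_mul, ← Int.cast_mul, ← natCast_natAbs_eq_abs]
      push_cast
      rfl
    have hq1 : (1 : ℝ) ≤ (16 * (a * b).natAbs : ℕ) := by
      have := Int.natAbs_pos.mpr h0
      exact_mod_cast (by omega : 1 ≤ 16 * (a * b).natAbs)
    have hq2 : ((16 * (a * b).natAbs : ℕ) : ℝ) ≤ Real.exp u := by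
      have := mul_le_mul ha2 hb2 (abs_nonneg _) (by positivity)
      rw [hq]
      nlinarith [Real.exp_pos u]
    have hq3 := Real.log_nonneg hq1
    have hq4 := (Real.log_le_iff_le_exp (by linarith)).mpr hq2
    exact Real.log_le_log (by linarith) (by linarith)
  have h2 := nonneg_of_primeSum_le (one_lt_one_add_inv_log hu) (t := B.card / 50) (s := u / 50)
    (Real.log_nonneg (by linarith)) (by positivity) h1 fun a ha => (hB a ha).2.2
  have h3 := tsum_primes_le (by linarith) hu
  by_contra! h
  have h4 : (B.card : ℝ) * ∑' p : Nat.Primes, (p : ℝ) ^ (-(1 + 1 / Real.log x)) ≤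
    B.card * (u + 1) := by gcongr
  have h5 : ((B.card : ℝ) / 50) ^ 2 * ∑' p : Nat.Primes, (p : ℝ) ^ (-(1 + 1 / Real.log x)) ≤
    (B.card / 50) ^ 2 * (u + 1) := by gcongr
  have h6 : (B.card : ℝ) ^ 2 * (Real.log (2 + u) + 1 / 2500) ≤ B.card ^ 2 * (u / 5000) := by
    gcongr
  have h7 : 0 ≤ (B.card : ℝ) * ((u + 1) - B.card * (u / 5000)) := by linarith
  have h8 : 0 < (B.card : ℝ) * (u / 5000 * B.card - (u + 1)) := by
    refine mul_pos (by linarith) ?_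
    nlinarith
  linarith

/-- The squarefree `n ≤ x` for which some quadratic character attached to a squarefree `m ≠ 1` of
absolute value at most `H` takes the value `1` at no prime factor of `n`. -/
def nonsplitSet (H x : ℝ) : Set ℕ :=
  {n | n ∈ squarefreeUpTo x ∧ ∃ m : ℤ, Squarefree m ∧ m ≠ 1 ∧ |(m : ℝ)| ≤ H ∧
    ∀ p ∈ n.primeFactors, quadChar m p ≠ 1}

lemma not_isSquare_of_squarefree {a : ℤ} (ha : Squarefree a) (ha1 : a ≠ 1) : ¬ IsSquare a := by
  simpa using not_isSquare_mul_of_squarefree ha squarefree_one ha1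

lemma ncard_nonsplitSet_le (hx : 1 < x) (hu1 : 1 ≤ u) (hu : Real.log x = Real.exp u)
    (hR : Real.log (2 + u) + 1 / 2500 ≤ u / 5000) :
    ((nonsplitSet (Real.exp (u / 2) / 256) x).ncard : ℝ) ≤
      12 * x * Real.exp (1 - u / 100) +
      (2 * Real.exp (u / 2) * (12 * x * Real.exp (101 - 13 / 25 * u)) +
      10000 * (12 * x * Real.exp (60 + ∑' p : Nat.Primes, ((p : ℝ) ^ 2)⁻¹ - u / 10))) := by
  classical
  set H := Real.exp (u / 2) / 256 with hH
  have hH0 : 0 ≤ H := by positivity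
  have hu0 : 0 ≤ u := by linarith
  set M : Finset ℤ := {m ∈ Finset.Icc (-⌊H⌋) ⌊H⌋ | Squarefree m ∧ m ≠ 1} with hM
  have hMm : ∀ m ∈ M, Squarefree m ∧ m ≠ 1 ∧ |(m : ℝ)| ≤ H := by
    intro m hm
    simp only [hM, Finset.mem_filter, Finset.mem_Icc, ← abs_le] at hm
    refine ⟨hm.2.1, hm.2.2, ?_⟩
    exact_mod_cast Int.le_floor.mp hm.1
  set F : Finset ℕ := {n ∈ squarefreeUpTo x | (n.primeFactors.card : ℝ) ≤ 4 / 5 * u} with hF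
  set G : Finset ℤ := {m ∈ M | -(u / 50) ≤ primeSum (quadChar m) (1 + 1 / Real.log x)} with hG
  set B : Finset ℤ := {m ∈ M | ¬ -(u / 50) ≤ primeSum (quadChar m) (1 + 1 / Real.log x)} with hBd
  let T (m : ℤ) : Finset ℕ := {n ∈ squarefreeUpTo x | ∀ p ∈ n.primeFactors, quadChar m p ≠ 1}
  let T' (m : ℤ) : Finset ℕ := {n ∈ T m | 4 / 5 * u ≤ n.primeFactors.card}
  have hsub : nonsplitSet H x ⊆ (F ∪ (G.biUnion T' ∪ B.biUnion T) : Finset ℕ) := by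
    rintro n ⟨hn, m, hm, hm1, hmH, hmp⟩
    simp only [Finset.coe_union, Set.mem_union, Finset.mem_coe, Finset.mem_biUnion]
    by_cases hnF : (n.primeFactors.card : ℝ) ≤ 4 / 5 * u
    · exact Or.inl (Finset.mem_filter.mpr ⟨hn, hnF⟩)
    have hmM : m ∈ M := by
      simp only [hM, Finset.mem_filter, Finset.mem_Icc, ← abs_le]
      exact ⟨Int.le_floor.mpr (by exact_mod_cast hmH), hm, hm1⟩
    have hnT : n ∈ T m := Finset.mem_filter.mpr ⟨hn, hmp⟩
    by_cases hmG : -(u / 50) ≤ primeSum (quadChar m) (1 + 1 / Real.log x)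
    · exact Or.inr (Or.inl ⟨m, Finset.mem_filter.mpr ⟨hmM, hmG⟩,
        Finset.mem_filter.mpr ⟨hnT, (not_le.mp hnF).le⟩⟩)
    · exact Or.inr (Or.inr ⟨m, Finset.mem_filter.mpr ⟨hmM, hmG⟩, hnT⟩)
  have hcard : ((nonsplitSet H x).ncard : ℝ) ≤
      F.card + (∑ m ∈ G, ((T' m).card : ℝ) + ∑ m ∈ B, ((T m).card : ℝ)) := by
    have h1 := Set.ncard_le_ncard hsub (Finset.finite_toSet _)
    rw [Set.ncard_coe_finset] at h1
    exact_mod_cast h1.trans ((Finset.card_union_le _ _).trans (add_le_add_right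
      ((Finset.card_union_le _ _).trans (add_le_add Finset.card_biUnion_le
        Finset.card_biUnion_le)) _))
  refine hcard.trans (add_le_add ?_ (add_le_add ?_ ?_))
  · exact card_few_primeFactors_le hx hu0 hu (Finset.filter_subset _ _)
      fun n hn => (Finset.mem_filter.mp hn).2
  · have hGc : (G.card : ℝ) ≤ 2 * Real.exp (u / 2) := by
      have h1 : G.card ≤ (Finset.Icc (-⌊H⌋) ⌊H⌋).card :=
        Finset.card_le_card ((Finset.filter_subset _ _).trans (Finset.filter_subset _ _))
      rw [Int.card_Icc] at h1
      have h2 : (G.card : ℤ) ≤ 2 * ⌊H⌋ + 1 := by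
        have := Int.floor_nonneg.mpr hH0
        omega
      have h3 : (G.card : ℝ) ≤ 2 * ⌊H⌋ + 1 := by exact_mod_cast h2
      linarith [Int.floor_le H, Real.one_le_exp (show 0 ≤ u / 2 by linarith)]
    refine le_trans ?_ (mul_le_mul_of_nonneg_right hGc (by positivity))
    rw [← nsmul_eq_mul]
    refine Finset.sum_le_card_nsmul _ _ _ fun m hm => ?_
    obtain ⟨hm, hmS⟩ := Finset.mem_filter.mp hm
    obtain ⟨hm1, -, hmH⟩ := hMm m hm
    exact card_nonsplit_le_of_le_primeSum hx hu0 hu hm1.ne_zero hmH hmS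
      ((Finset.filter_subset _ _).trans (Finset.filter_subset _ _))
      (fun n hn => (Finset.mem_filter.mp hn).2)
      fun n hn => (Finset.mem_filter.mp (Finset.mem_filter.mp hn).1).2
  · have hBc : (B.card : ℝ) ≤ 10000 := by
      refine card_primeSum_le_neg hu1 hu hR fun m hm => ?_
      obtain ⟨hm, hmS⟩ := Finset.mem_filter.mp hm
      obtain ⟨hm1, -, hmH⟩ := hMm m hm
      exact ⟨hm1, hmH, (not_le.mp hmS).le⟩
    refine le_trans ?_ (mul_le_mul_of_nonneg_right hBc (by positivity))
    rw [← nsmul_eq_mul]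
    refine Finset.sum_le_card_nsmul _ _ _ fun m hm => ?_
    obtain ⟨hm1, hm2, hmH⟩ := hMm m (Finset.mem_filter.mp hm).1
    exact card_nonsplit_le hx hu0 hu hm1.ne_zero (not_isSquare_of_squarefree hm1 hm2) hmH
      (Finset.filter_subset _ _) fun n hn => (Finset.mem_filter.mp hn).2

lemma exists_ncard_nonsplitSet_le : ∃ A : ℝ, 0 < A ∧ ∀ x u : ℝ, 1 < x → 1 ≤ u →
    Real.log x = Real.exp u → Real.log (2 + u) + 1 / 2500 ≤ u / 5000 →
    ((nonsplitSet (Real.exp (u / 2) / 256) x).ncard : ℝ) ≤ A * Real.exp (-(u / 100)) * x := by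
  set C := ∑' p : Nat.Primes, ((p : ℝ) ^ 2)⁻¹
  refine ⟨12 * (Real.exp 1 + 2 * Real.exp 101 + 10000 * Real.exp (60 + C)), by positivity,
    fun x u hx hu1 hu hR => (ncard_nonsplitSet_le hx hu1 hu hR).trans ?_⟩
  have h1 : Real.exp (1 - u / 100) = Real.exp 1 * Real.exp (-(u / 100)) := by
    rw [← Real.exp_add, sub_eq_add_neg]
  have h2 : Real.exp (u / 2) * Real.exp (101 - 13 / 25 * u) ≤
      Real.exp 101 * Real.exp (-(u / 100)) := by
    rw [← Real.exp_add, ← Real.exp_add]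
    exact Real.exp_le_exp.mpr (by linarith)
  have h3 : Real.exp (60 + C - u / 10) ≤ Real.exp (60 + C) * Real.exp (-(u / 100)) := by
    rw [← Real.exp_add]
    exact Real.exp_le_exp.mpr (by linarith)
  have hx0 : 0 ≤ 12 * x := by linarith
  rw [h1]
  linarith [mul_le_mul_of_nonneg_left h2 hx0, mul_le_mul_of_nonneg_left h3 hx0]

lemma ncard_badWitness_le {H : ℝ} (hx : 0 ≤ x) {H' : ℝ} (hH : H ≤ H') :
    {n : ℕ | 0 < n ∧ (n : ℝ) ≤ x ∧ Squarefree n ∧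
      ∃ (K : Type) (instF : Field K) (instN : @NumberField K instF),
        @BadWitness H n K instF instN}.ncard ≤ (nonsplitSet H' x).ncard := by
  refine Set.ncard_le_ncard ?_ ((squarefreeUpTo x).finite_toSet.subset fun n hn => hn.1)
  rintro n ⟨hn0, hnx, hns, K, instF, instN, hK⟩
  obtain ⟨m, hm, hm1, hmH, hmp⟩ := exists_squarefree_of_badWitness hK
  refine ⟨(mem_squarefreeUpTo hx).mpr ⟨hn0, hnx, hns⟩, m, hm, hm1, hmH.trans hH, fun p hp => ?_⟩
  have hp' := Nat.prime_of_mem_primeFactors hp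
  rw [quadChar_apply m hp'.ne_zero]
  exact_mod_cast hmp p hp' (Nat.dvd_of_mem_primeFactors hp)

end Counting

/-- If `h(x) = o((log x)^{1/2})`, then the number of squarefree positive integers `n ≤ x` having,
for some quadratic field `K` with `|Δ_K| ≤ h(x)`, no prime factor split in `K`, is `o(x)`. -/
theorem stmt_11 (h : ℝ → ℝ)
    (hh : Filter.Tendsto (fun x => h x / Real.sqrt (Real.log x)) Filter.atTop (nhds 0)) :
    ∀ ε : ℝ, 0 < ε → ∃ x₀ : ℝ, ∀ x : ℝ, x₀ ≤ x →
      ({n : ℕ | 0 < n ∧ (n : ℝ) ≤ x ∧ Squarefree n ∧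
          ∃ (K : Type) (instF : Field K) (instN : @NumberField K instF),
            @BadWitness (h x) n K instF instN}.ncard : ℝ) ≤ ε * x := by
  intro ε hε
  rw [← Filter.eventually_atTop]
  obtain ⟨A, hA, hcount⟩ := exists_ncard_nonsplitSet_le
  have hlog : Filter.Tendsto (fun x => Real.log (Real.log x)) Filter.atTop Filter.atTop :=
    Real.tendsto_log_atTop.comp Real.tendsto_log_atTop
  have hexp : Filter.Tendsto (fun u : ℝ => A * Real.exp (-(u / 100))) Filter.atTop (nhds 0) := by
    have := (Real.tendsto_exp_neg_atTop_nhds_zero.comp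
      (Filter.tendsto_id.atTop_div_const (show (0 : ℝ) < 100 by norm_num))).const_mul A
    simpa using this
  have hR : ∀ᶠ u : ℝ in Filter.atTop, Real.log (2 + u) + 1 / 2500 ≤ u / 5000 := by
    have h1 := (Real.isLittleO_log_id_atTop.comp_tendsto
      (Filter.tendsto_atTop_add_const_left Filter.atTop (2 : ℝ) Filter.tendsto_id)).bound
      (show (0 : ℝ) < 1 / 10000 by norm_num)
    filter_upwards [h1, Filter.eventually_ge_atTop 10] with u h1 h2
    simp only [Function.comp, id, Real.norm_eq_abs] at h1
    rw [abs_of_nonneg (show 0 ≤ 2 + u by linarith)] at h1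
    linarith [le_abs_self (Real.log (2 + u))]
  filter_upwards [hlog.eventually hR, hlog.eventually (hexp.eventually_le_const hε),
    hlog.eventually_ge_atTop 1, hh.eventually_le_const (show (0 : ℝ) < 1 / 256 by norm_num),
    Filter.eventually_gt_atTop 1] with x h1 h2 h3 h4 hx
  have hl : 0 < Real.log x := Real.log_pos hx
  have hs : Real.exp (Real.log (Real.log x) / 2) = Real.sqrt (Real.log x) := by
    rw [← Real.log_sqrt hl.le, Real.exp_log (Real.sqrt_pos.mpr hl)]
  have hH : h x ≤ Real.exp (Real.log (Real.log x) / 2) / 256 := by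
    rw [div_le_iff₀ (Real.sqrt_pos.mpr hl)] at h4
    rw [hs]
    linarith
  calc _ ≤ ((nonsplitSet (Real.exp (Real.log (Real.log x) / 2) / 256) x).ncard : ℝ) := by
        exact_mod_cast ncard_badWitness_le (by linarith) hH
    _ ≤ _ := hcount x _ hx h3 (Real.exp_log hl).symm h1
    _ ≤ ε * x := by gcongr
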